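/- arXiv:1709.09914 — 7 statements merged into one kernel-verified Lean document; each statement's English description precedes it below -/
import Mathlib

section
/- Let T ≥ 1 and x be real numbers with T + 1 = c0·exp(c4·√(log x)) and log x ≥ (c4⁻¹·log(2/c0))². Then φ(T) ≤ 230.911 · r2^(3/2) · log(D·N) · (log x)^(1/2). -/
open Real MeasureTheory

/-- The comparison of `∑ n⁻ˢ` with `∫ x⁻ˢ` gives `ζ(s) ≤ s / (s - 1)` for real `s > 1`. -/
lemma tsum_one_div_nat_add_one_rpow_le {s : ℝ} (hs : 1 < s) :
    ∑' n : ℕ, 1 / (n + 1 : ℝ) ^ s ≤ s / (s - 1) := by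
  have h := ZetaAsymptotics.termTSum_of_lt hs
  have h0 : 0 ≤ ZetaAsymptotics.termTSum s :=
    tsum_nonneg fun n => ZetaAsymptotics.term_nonneg (n + 1) s
  have hs0 : 0 < s := by linarith
  rw [h] at h0
  have h1 : 1 / s * ∑' n : ℕ, 1 / (n + 1 : ℝ) ^ s ≤ 1 / (s - 1) := by linarith
  calc ∑' n : ℕ, 1 / (n + 1 : ℝ) ^ s = s * (1 / s * ∑' n : ℕ, 1 / (n + 1 : ℝ) ^ s) := by
        field_simp
    _ ≤ s * (1 / (s - 1)) := by gcongr
    _ = s / (s - 1) := by ring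

lemma riemannZeta_re_eq_tsum {s : ℝ} (hs : 1 < s) :
    (riemannZeta (s : ℂ)).re = ∑' n : ℕ, 1 / (n + 1 : ℝ) ^ s := by
  rw [zeta_eq_tsum_one_div_nat_add_one_cpow (by simpa using hs)]
  have : ∀ n : ℕ, (1 : ℂ) / ((n : ℂ) + 1) ^ (s : ℂ) = ((1 / (n + 1 : ℝ) ^ s : ℝ) : ℂ) := by
    intro n
    rw [Complex.ofReal_div, Complex.ofReal_cpow (by positivity)]
    push_cast
    rfl
  simp_rw [this]
  rw [← Complex.ofReal_tsum, Complex.ofReal_re]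

lemma riemannZeta_re_pos {s : ℝ} (hs : 1 < s) : 0 < (riemannZeta (s : ℂ)).re := by
  rw [riemannZeta_re_eq_tsum hs]
  have hsum : Summable fun n : ℕ => 1 / (n + 1 : ℝ) ^ s := by
    simpa using (summable_nat_add_iff 1).mpr (Real.summable_one_div_nat_rpow.mpr hs)
  exact hsum.tsum_pos (fun n => by positivity) 0 (by norm_num)

lemma log_three_mem_Icc : Real.log 3 ∈ Set.Icc (1.097 : ℝ) 1.11 := by
  have h1 := Real.log_two_gt_d9
  have h2 := Real.log_two_lt_d9
  have h3 : Real.log ((2 : ℝ) ^ 19) ≤ Real.log ((3 : ℝ) ^ 12) :=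
    Real.log_le_log (by norm_num) (by norm_num)
  have h4 : Real.log ((3 : ℝ) ^ 5) ≤ Real.log ((2 : ℝ) ^ 8) :=
    Real.log_le_log (by norm_num) (by norm_num)
  simp only [Real.log_pow] at h3 h4
  push_cast at h3 h4
  constructor <;> linarith

lemma log_five_le : Real.log 5 ≤ 1.618 := by
  have h2 := Real.log_two_lt_d9
  have h3 : Real.log ((5 : ℝ) ^ 3) ≤ Real.log ((2 : ℝ) ^ 7) :=
    Real.log_le_log (by norm_num) (by norm_num)
  simp only [Real.log_pow] at h3
  push_cast at h3
  linarith

lemma log_two_point_eight_le : Real.log 2.8 ≤ 1.04 := by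
  have h2 := Real.log_two_lt_d9
  have h3 : Real.log ((2.8 : ℝ) ^ 2) ≤ Real.log ((2 : ℝ) ^ 3) :=
    Real.log_le_log (by norm_num) (by norm_num)
  simp only [Real.log_pow] at h3
  push_cast at h3
  linarith

lemma log_two_pi_ge : 1.79 ≤ Real.log (2 * π) := by
  have h2 := Real.log_two_gt_d9
  have h3 := log_three_mem_Icc.1
  have h : Real.log (2 * 3) ≤ Real.log (2 * π) :=
    Real.log_le_log (by norm_num) (by linarith [Real.pi_gt_three])
  rw [Real.log_mul (by norm_num) (by norm_num)] at h
  linarith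

/-- The tangent line of `log` at `256`. -/
lemma log_le_tangent {z : ℝ} (hz : 0 < z) : Real.log z ≤ 5.5452 + z / 256 - 1 := by
  have h2 := Real.log_two_lt_d9
  have h := Real.log_le_sub_one_of_pos (show 0 < z / 256 by positivity)
  rw [Real.log_div hz.ne' (by norm_num), show (256 : ℝ) = 2 ^ 8 by norm_num, Real.log_pow] at h
  push_cast at h
  linarith

lemma mul_le_sqrt_mul_sqrt {r w : ℝ} (hr : 0 ≤ r) (hw : 1 ≤ w) :
    1.414 * r ≤ Real.sqrt r * Real.sqrt (2 * w * r) := by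
  rw [← Real.sqrt_mul hr]
  apply Real.le_sqrt_of_sq_le
  nlinarith [mul_nonneg (sq_nonneg r) (sub_nonneg.2 hw), sq_nonneg r]

lemma le_rpow_three_halves_mul {r w Y S : ℝ} (hr : 1 ≤ r) (hw : 1 ≤ w) (hY : 0 ≤ Y)
    (hYS : Y = 2 * 0.7761 * r * (1 / Real.sqrt (2 * w * r)) * S) :
    210.3 * r * Y ≤ 230.911 * r ^ ((3 : ℝ) / 2) * S := by
  have hr0 : 0 < r := by linarith
  have hw0 : 0 < w := by linarith
  have hpow : r ^ ((3 : ℝ) / 2) = r * Real.sqrt r := by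
    rw [show (3 : ℝ) / 2 = 1 + 1 / 2 by norm_num, Real.rpow_add hr0, Real.rpow_one,
      ← Real.sqrt_eq_rpow]
  have hq : 0 < Real.sqrt (2 * w * r) := Real.sqrt_pos.2 (by positivity)
  have hSY : r * S = Real.sqrt (2 * w * r) * (Y / 1.5522) := by
    rw [hYS]
    field_simp
    ring
  have hS1 : r ^ ((3 : ℝ) / 2) * S = Real.sqrt r * Real.sqrt (2 * w * r) * (Y / 1.5522) := by
    rw [hpow, mul_right_comm, hSY]
    ring
  have hS2 : 1.414 * r * (Y / 1.5522) ≤ r ^ ((3 : ℝ) / 2) * S := by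
    rw [hS1]
    exact mul_le_mul_of_nonneg_right (mul_le_sqrt_mul_sqrt hr0.le hw) (by positivity)
  have hrY : 0 ≤ r * Y := by positivity
  calc 210.3 * r * Y = 210.3 * (r * Y) := by ring
    _ ≤ (230.911 * 1.414 / 1.5522) * (r * Y) :=
        mul_le_mul_of_nonneg_right (by norm_num) hrY
    _ = 230.911 * (1.414 * r * (Y / 1.5522)) := by ring
    _ ≤ 230.911 * (r ^ ((3 : ℝ) / 2) * S) := by gcongr
    _ = _ := by ring

lemma log_riemannZeta_five_fourths_le :
    Real.log (riemannZeta ((1 + 1 / 4 : ℝ) : ℂ)).re ≤ 1.618 := by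
  have hs : (1 : ℝ) < 1 + 1 / 4 := by norm_num
  refine le_trans (Real.log_le_log (riemannZeta_re_pos hs) ?_) log_five_le
  rw [riemannZeta_re_eq_tsum hs]
  refine (tsum_one_div_nat_add_one_rpow_le hs).trans ?_
  norm_num

/-- The final numerical comparison, per unit of `r2`; `Y` stands for `L T` and `ℓ` for
`log (D * N)`. -/
lemma bilinear_bound {Y ℓ : ℝ} (hY : 3.269 ≤ Y) (hℓ : 2.194 ≤ ℓ) :
    64 * (5.5452 + (1 + 75.472 * Y) / 256 - 1) + 48 * (Real.log 3 - Real.log 2)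
      + 48 / 1.5522 * (Y - 2 * Real.log 3) + 32 * 1.04 - 48 * 1.79 + 24 * ℓ + 64 * 1.618
      + 4 * 75.472 * Y + 0.01 ≤ 210.3 * Y * ℓ := by
  obtain ⟨h3l, h3u⟩ := log_three_mem_Icc
  have h2l := Real.log_two_gt_d9
  have h := mul_nonneg (sub_nonneg.2 hℓ) (sub_nonneg.2 hY)
  linarith

set_option maxHeartbeats 1000000 in
/-- under the substitution `T + 1 = c0 * exp (c4 * √(log x))`,
the function `φ` from Lemma 2 of the paper satisfies
`φ T ≤ 230.911 * r2^(3/2) * log (D * N) * (log x)^(1/2)`. -/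
theorem stmt_0
    (r2 : ℕ) (hr2 : 1 ≤ r2)
    (D N : ℝ) (hD : 9 ≤ D) (hN : 1 ≤ N)
    (E0 : ℝ) (hE0 : E0 = 0 ∨ E0 = 1)
    (εχ : ℝ) (hεχ : εχ = 0 ∨ εχ = 1)
    (w : ℝ) (hw : 1 ≤ w)
    (A0 A3 A4 η : ℝ)
    (hA0 : A0 = 0.7761) (hA3 : A3 = 75.472) (hA4 : A4 = 0.010) (hη : η = 1/4)
    (A : ℝ) (hA : A = (2 * π) ^ (-(r2 : ℝ)) * Real.sqrt (D * N))
    (L : ℝ → ℝ)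
    (hL : ∀ t : ℝ, L t = Real.log D + A0 * Real.log ((|t| + 1) ^ (2 * r2) * N ^ (1 - E0)))
    (φ : ℝ → ℝ)
    (hφ : ∀ t : ℝ, φ t =
      32 * Real.log ((1 + A3 * L t) ^ (2 * r2) * (|t| + 2) ^ ((r2 : ℝ) * (1 + 2 * η)))
      + 32 * Real.log (1.4 * (1 + εχ) * A ^ (1 + 2 * η)
          * ((riemannZeta (1 + (η : ℂ))).re) ^ (2 * r2))
      + 4 * A3 * r2 * L t + A4 * r2 / L t)
    (c0 c4 : ℝ)
    (hc0 : c0 = D ^ (-(1 / (2 * A0 * r2))) * N ^ (-((1 - E0) / (2 * r2))))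
    (hc4 : c4 = 1 / Real.sqrt (2 * w * r2))
    (T x : ℝ) (hT : 1 ≤ T)
    (hTx : T + 1 = c0 * Real.exp (c4 * Real.sqrt (Real.log x)))
    (hx : (c4⁻¹ * Real.log (2 / c0)) ^ 2 ≤ Real.log x) :
    φ T ≤ 230.911 * (r2 : ℝ) ^ ((3 : ℝ) / 2) * Real.log (D * N) * Real.sqrt (Real.log x) := by
  have hrR : (1 : ℝ) ≤ r2 := by exact_mod_cast hr2
  set r : ℝ := (r2 : ℝ) with hr
  set S := Real.sqrt (Real.log x) with hS
  have hD0 : 0 < D := by linarith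
  have hN0 : 0 < N := by linarith
  have hT1 : 0 < T + 1 := by linarith
  have habs : |T| = T := abs_of_nonneg (by linarith)
  have hlogN : 0 ≤ Real.log N := Real.log_nonneg hN
  have hE : 0 ≤ 1 - E0 := by rcases hE0 with h | h <;> rw [h] <;> norm_num
  obtain ⟨h3l, h3u⟩ := log_three_mem_Icc
  have h2l := Real.log_two_gt_d9
  have h2u := Real.log_two_lt_d9
  have hlogD : 2 * Real.log 3 ≤ Real.log D := by
    have h : Real.log ((3 : ℝ) ^ 2) ≤ Real.log D :=
      Real.log_le_log (by norm_num) (by linarith)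
    rw [Real.log_pow] at h
    exact_mod_cast h
  have hDN : Real.log (D * N) = Real.log D + Real.log N := Real.log_mul hD0.ne' hN0.ne'
  have hLT : L T = Real.log D + A0 * (2 * r * Real.log (T + 1) + (1 - E0) * Real.log N) := by
    rw [hL, habs, Real.log_mul (by positivity) (by positivity), Real.log_pow, Real.log_rpow hN0]
    push_cast
    rfl
  have hlogT : Real.log (T + 1) = -(1 / (2 * A0 * r)) * Real.log D
      + -((1 - E0) / (2 * r)) * Real.log N + c4 * S := by
    rw [hTx, hc0, Real.log_mul (by positivity) (by positivity),
      Real.log_mul (by positivity) (by positivity), Real.log_rpow hD0, Real.log_rpow hN0,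
      Real.log_exp]
  have hA0pos : 0 < A0 := by rw [hA0]; norm_num
  have hLS : L T = 2 * A0 * r * c4 * S := by
    rw [hLT, hlogT]
    field_simp
    ring
  have hlog2T : Real.log 2 ≤ Real.log (T + 1) := Real.log_le_log (by norm_num) (by linarith)
  have hYT : 1.5522 * (r * Real.log (T + 1)) ≤ L T - 2 * Real.log 3 := by
    have := mul_nonneg hE hlogN
    rw [hLT, hA0]
    nlinarith
  have hrT : Real.log 2 ≤ r * Real.log (T + 1) := by nlinarith
  have hYlow : 3.269 ≤ L T := by linarith
  set Y := L T with hY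
  have hlogT2 : Real.log (T + 2) ≤ Real.log (T + 1) + (Real.log 3 - Real.log 2) := by
    rw [← Real.log_div (by norm_num) (by norm_num), ← Real.log_mul (by positivity) (by norm_num)]
    exact Real.log_le_log (by linarith) (by linarith)
  have hlogY : Real.log (1 + A3 * Y) ≤ 5.5452 + (1 + A3 * Y) / 256 - 1 :=
    log_le_tangent (by rw [hA3]; linarith)
  have hR : 210.3 * r * Y ≤ 230.911 * r ^ ((3 : ℝ) / 2) * S :=
    le_rpow_three_halves_mul hrR hw (by linarith) (by rw [hLS, hA0, hc4])
  have hs : (1 : ℝ) < 1 + η := by rw [hη]; norm_num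
  have hzcast : (1 + (η : ℂ)) = ((1 + η : ℝ) : ℂ) := by push_cast; rfl
  have hzpos := riemannZeta_re_pos hs
  have hz5 : Real.log (riemannZeta ((1 + η : ℝ) : ℂ)).re ≤ 1.618 := by
    rw [hη]
    exact log_riemannZeta_five_fourths_le
  have hApos : 0 < A := by rw [hA]; positivity
  have hlogA : Real.log A = -r * Real.log (2 * π) + Real.log (D * N) / 2 := by
    rw [hA, Real.log_mul (by positivity) (by positivity), Real.log_rpow (by positivity),
      Real.log_sqrt (by positivity)]
  have hε : 0 < 1.4 * (1 + εχ) ∧ Real.log (1.4 * (1 + εχ)) ≤ 1.04 := by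
    have h : 0 < 1.4 * (1 + εχ) ∧ 1.4 * (1 + εχ) ≤ 2.8 := by
      rcases hεχ with h | h <;> rw [h] <;> norm_num
    exact ⟨h.1, (Real.log_le_log h.1 h.2).trans log_two_point_eight_le⟩
  have hA3Y : 0 < 1 + A3 * Y := by rw [hA3]; linarith
  have hlog1 : Real.log ((1 + A3 * Y) ^ (2 * r2) * (|T| + 2) ^ (r * (1 + 2 * η)))
      = 2 * r * Real.log (1 + A3 * Y) + 1.5 * (r * Real.log (T + 2)) := by
    have hT2 : 0 < T + 2 := by linarith
    rw [habs, Real.log_mul (by positivity) (by positivity), Real.log_pow, Real.log_rpow hT2, hη]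
    push_cast
    ring
  have hlog2 : Real.log (1.4 * (1 + εχ) * A ^ (1 + 2 * η)
        * ((riemannZeta (1 + (η : ℂ))).re) ^ (2 * r2))
      = Real.log (1.4 * (1 + εχ)) + 1.5 * Real.log A
        + 2 * r * Real.log (riemannZeta ((1 + η : ℝ) : ℂ)).re := by
    rw [hzcast, Real.log_mul (mul_pos hε.1 (by positivity)).ne' (by positivity),
      Real.log_mul hε.1.ne' (by positivity), Real.log_pow, Real.log_rpow hApos, hη]
    push_cast
    ring
  have hA4Y : A4 * r / Y ≤ 0.01 * r := by
    rw [hA4, div_le_iff₀ (by linarith)]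
    nlinarith
  rw [hφ, ← hY, hlog1, hlog2, hlogA]
  have hpi := log_two_pi_ge
  set ℓ := Real.log (D * N)
  have hℓ : 2.194 ≤ ℓ := by linarith
  have hfinal := bilinear_bound hYlow hℓ
  rw [← hA3] at hfinal
  have e1 := mul_le_mul_of_nonneg_left hfinal (zero_le_one.trans hrR)
  have e2 := mul_le_mul_of_nonneg_right hR (show 0 ≤ ℓ by linarith)
  have e3 := mul_le_mul_of_nonneg_left hlogY (zero_le_one.trans hrR)
  have e4 := mul_le_mul_of_nonneg_left hlogT2 (zero_le_one.trans hrR)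
  have e5 := mul_le_mul_of_nonneg_left hz5 (zero_le_one.trans hrR)
  have e6 := mul_le_mul_of_nonneg_left hpi (zero_le_one.trans hrR)
  have e7 : Y - 2 * Real.log 3 ≤ r * (Y - 2 * Real.log 3) :=
    le_mul_of_one_le_left (by linarith) hrR
  have e8 : ℓ ≤ r * ℓ := le_mul_of_one_le_left (by linarith) hrR
  linarith [hε.2]
end

section
/- For every real number T ≥ 1, ∫_T^∞ t^(−2)·L(t) dt ≤ c5·T^(−1)·log(e·(T+4)), where c5 = 1.09·r2·log( D·N^(A0·(1−E0)) ). -/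
open Real MeasureTheory

open Filter Topology in
theorem tendsto_log_add_one_div_atTop :
    Tendsto (fun t : ℝ => Real.log (t + 1) / t) atTop (𝓝 0) := by
  have h := (Real.tendsto_pow_log_div_mul_add_atTop 1 (-1) 1 one_ne_zero).comp
    (tendsto_atTop_add_const_right atTop (1 : ℝ) tendsto_id)
  refine h.congr fun t => ?_
  simp

open Filter Topology in
/-- The integral of `t⁻² (M + K log (t + 1))` over `(T, ∞)`. -/
theorem integral_Ioi_rpow_neg_two_mul_add_log {M K T : ℝ} (hM : 0 ≤ M) (hK : 0 ≤ K) (hT : 0 < T) :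
    (∫ t in Set.Ioi T, t ^ (-(2 : ℝ)) * (M + K * Real.log (t + 1))) =
      (M + K * (Real.log (T + 1) + T * (Real.log (T + 1) - Real.log T))) / T := by
  have hderiv : ∀ t ∈ Set.Ici T, HasDerivAt
      (fun t : ℝ => -((M + K * Real.log (t + 1)) / t) - K * (Real.log (t + 1) - Real.log t))
      (t ^ (-(2 : ℝ)) * (M + K * Real.log (t + 1))) t := by
    intro t ht
    have ht0 : 0 < t := hT.trans_le ht
    have ht1 : t + 1 ≠ 0 := by positivity
    have hlog : HasDerivAt (fun t : ℝ => Real.log (t + 1)) (1 / (t + 1)) t :=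
      ((hasDerivAt_id t).add_const 1).log ht1
    have h := (((hlog.const_mul K).const_add M).div (hasDerivAt_id t) ht0.ne').neg.sub
      ((hlog.sub (Real.hasDerivAt_log ht0.ne')).const_mul K)
    refine h.congr_deriv ?_
    rw [Real.rpow_neg ht0.le, Real.rpow_two]
    simp only [id]
    field_simp
    ring
  have hnonneg : ∀ t ∈ Set.Ioi T, 0 ≤ t ^ (-(2 : ℝ)) * (M + K * Real.log (t + 1)) := by
    intro t ht
    have ht0 : 0 < t := hT.trans ht
    have := Real.log_nonneg (by linarith : 1 ≤ t + 1)
    positivity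
  have hlim : Tendsto
      (fun t : ℝ => -((M + K * Real.log (t + 1)) / t) - K * (Real.log (t + 1) - Real.log t))
      atTop (𝓝 0) := by
    have h := ((tendsto_const_nhds (x := M)).div_atTop tendsto_id).add
      (tendsto_log_add_one_div_atTop.const_mul K) |>.neg.sub
      ((Real.tendsto_log_comp_add_sub_log 1).const_mul K)
    simp only [mul_zero, add_zero, neg_zero, sub_zero] at h
    refine h.congr fun t => ?_
    simp only [id]
    ring
  rw [integral_Ioi_of_hasDerivAt_of_nonneg' hderiv hnonneg hlim]
  field_simp
  ring

theorem mul_log_add_one_sub_log_le_one {T : ℝ} (hT : 0 < T) :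
    T * (Real.log (T + 1) - Real.log T) ≤ 1 := by
  rw [← Real.log_div (by positivity) hT.ne']
  have h := Real.log_le_sub_one_of_pos (show 0 < (T + 1) / T by positivity)
  calc T * Real.log ((T + 1) / T) ≤ T * ((T + 1) / T - 1) := by gcongr
    _ = 1 := by field_simp; ring

/-- for `T ≥ 1`, `∫_T^∞ t⁻² L(t) dt ≤ c5 T⁻¹ log (e (T+4))`
with `c5 = 1.09 r2 log (D N^(A0 (1-E0)))`. -/
theorem stmt_5
    (r2 : ℕ) (hr2 : 1 ≤ r2)
    (D N : ℝ) (hD : 9 ≤ D) (hN : 1 ≤ N)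
    (E0 : ℝ) (hE0 : E0 = 0 ∨ E0 = 1)
    (A0 : ℝ) (hA0 : A0 = 0.7761)
    (L : ℝ → ℝ)
    (hL : ∀ t : ℝ, L t = Real.log D + A0 * Real.log ((|t| + 1) ^ (2 * r2) * N ^ (1 - E0)))
    (c5 : ℝ) (hc5 : c5 = 1.09 * r2 * Real.log (D * N ^ (A0 * (1 - E0))))
    (T : ℝ) (hT : 1 ≤ T) :
    (∫ t in Set.Ioi T, t ^ (-(2 : ℝ)) * L t) ≤
      c5 * T⁻¹ * Real.log (Real.exp 1 * (T + 4)) := by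
  have hN0 : 0 < N := by linarith
  have hD0 : 0 < D := by linarith
  have hT0 : 0 < T := by linarith
  have hr : (1 : ℝ) ≤ r2 := by exact_mod_cast hr2
  have hE : 0 ≤ 1 - E0 := by rcases hE0 with h | h <;> simp [h]
  set M : ℝ := Real.log D + A0 * ((1 - E0) * Real.log N) with hMdef
  have hc : c5 = 1.09 * r2 * M := by
    rw [hc5, Real.log_mul hD0.ne' (by positivity), Real.log_rpow hN0, hMdef, mul_assoc A0]
  have hM : 2.1972 ≤ M := by
    have h9 : Real.log 9 ≤ Real.log D := Real.log_le_log (by norm_num) hD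
    have h3 : Real.log 9 = 2 * Real.log 3 := by
      rw [show (9 : ℝ) = 3 ^ 2 by norm_num, Real.log_pow]; norm_num
    have hA : 0 ≤ A0 := by rw [hA0]; norm_num
    have hNlog : 0 ≤ A0 * ((1 - E0) * Real.log N) :=
      mul_nonneg hA (mul_nonneg hE (Real.log_nonneg hN))
    linarith [Real.log_three_gt_d9]
  have hint : (∫ t in Set.Ioi T, t ^ (-(2 : ℝ)) * L t) =
      ∫ t in Set.Ioi T, t ^ (-(2 : ℝ)) * (M + A0 * (2 * r2) * Real.log (t + 1)) := by
    refine setIntegral_congr_fun measurableSet_Ioi fun t ht => ?_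
    have ht0 : 0 < t := hT0.trans ht
    simp only [hL]
    rw [abs_of_pos ht0, Real.log_mul (by positivity) (by positivity), Real.log_pow,
      Real.log_rpow hN0]
    push_cast
    ring
  have hK : 0 ≤ A0 * (2 * r2) := by rw [hA0]; positivity
  rw [hint, integral_Ioi_rpow_neg_two_mul_add_log (by linarith) hK hT0, hc,
    Real.log_mul (Real.exp_ne_zero 1) (by positivity), Real.log_exp, div_eq_mul_inv,
    mul_right_comm _ T⁻¹]
  refine mul_le_mul_of_nonneg_right ?_ (by positivity)
  have hlog : Real.log (T + 1) ≤ Real.log (T + 4) := Real.log_le_log (by linarith) (by linarith)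
  have hlog5 : Real.log 5 ≤ Real.log (T + 4) := Real.log_le_log (by norm_num) (by linarith)
  have hx : 2.6094 ≤ 1 + Real.log (T + 4) := by linarith [Real.log_five_gt_d9]
  have hsum : Real.log (T + 1) + T * (Real.log (T + 1) - Real.log T) ≤ 1 + Real.log (T + 4) := by
    linarith [mul_log_add_one_sub_log_le_one hT0]
  have key : M + 1.5522 * (1 + Real.log (T + 4)) ≤ 1.09 * M * (1 + Real.log (T + 4)) := by
    nlinarith [mul_nonneg (sub_nonneg.2 hM) (sub_nonneg.2 hx)]
  calc M + A0 * (2 * r2) * (Real.log (T + 1) + T * (Real.log (T + 1) - Real.log T))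
      ≤ r2 * M + A0 * (2 * r2) * (1 + Real.log (T + 4)) := by
        gcongr
        exact le_mul_of_one_le_left (by linarith) hr
    _ = r2 * (M + 1.5522 * (1 + Real.log (T + 4))) := by rw [hA0]; ring
    _ ≤ r2 * (1.09 * M * (1 + Real.log (T + 4))) := by gcongr
    _ = 1.09 * r2 * M * (1 + Real.log (T + 4)) := by ring
end

section
/- For every real number T ≥ 1, ∫_T^∞ t^(−2)·2·r2·log(1 + A3·L(t)) dt ≤ c6·T^(−1)·log(e·(T+4)), where c6 = 11.605·r2²·log( D·N^(A0·(1−E0)) ). -/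
open Real MeasureTheory

/-- An improper integral bound obtained from the primitive `-(1 + log (t + 4)) / t`. -/
theorem setIntegral_Ioi_le_mul_one_add_log_div {f : ℝ → ℝ} {K T : ℝ} (hK : 0 ≤ K) (hT : 1 ≤ T)
    (hf0 : ∀ t ∈ Set.Ioi T, 0 ≤ f t)
    (hf : ∀ t ∈ Set.Ioi T, f t ≤ K * (log (t + 4) / t ^ 2)) :
    ∫ t in Set.Ioi T, f t ≤ K * ((1 + log (T + 4)) / T) := by
  have hderiv : ∀ t ∈ Set.Ici T, HasDerivAt (fun t : ℝ => -((1 + log (t + 4)) / t))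
      (-((1 / (t + 4) * t - (1 + log (t + 4)) * 1) / t ^ 2)) t := by
    intro t ht
    have ht : T ≤ t := ht
    have h4 : t + 4 ≠ 0 := by linarith
    have ht0 : t ≠ 0 := by linarith
    exact (((((hasDerivAt_id t).add_const 4).log h4).const_add 1).div (hasDerivAt_id t) ht0).neg
  have hlow : ∀ t ∈ Set.Ioi T, log (t + 4) / t ^ 2 ≤
      -((1 / (t + 4) * t - (1 + log (t + 4)) * 1) / t ^ 2) := by
    intro t ht
    have ht : T < t := ht
    have h1 : 1 / (t + 4) * t ≤ 1 := by
      rw [one_div_mul_eq_div, div_le_one (by linarith)]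
      linarith
    rw [← neg_div]
    gcongr
    linarith
  have hnonneg : ∀ t ∈ Set.Ioi T,
      0 ≤ -((1 / (t + 4) * t - (1 + log (t + 4)) * 1) / t ^ 2) := by
    intro t ht
    have ht' : T < t := ht
    have : 0 ≤ log (t + 4) := log_nonneg (by linarith)
    exact le_trans (by positivity) (hlow t ht)
  have hlim : Filter.Tendsto (fun t : ℝ => -((1 + log (t + 4)) / t)) Filter.atTop (nhds 0) := by
    have h1 : (fun t : ℝ => 1 + log (t + 4)) =o[Filter.atTop] fun t : ℝ => t + 4 :=
      (Asymptotics.isLittleO_const_id_atTop (1 : ℝ) |>.add isLittleO_log_id_atTop).comp_tendsto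
        (Filter.tendsto_atTop_add_const_right _ 4 Filter.tendsto_id)
    have h2 : (fun t : ℝ => t + 4) =O[Filter.atTop] fun t : ℝ => t :=
      (Asymptotics.isBigO_refl _ _).add (Asymptotics.isLittleO_const_id_atTop (4 : ℝ)).isBigO
    simpa using (h1.trans_isBigO h2).tendsto_div_nhds_zero.neg
  have hint := integrableOn_Ioi_deriv_of_nonneg' hderiv hnonneg hlim
  have hval := integral_Ioi_of_hasDerivAt_of_nonneg' hderiv hnonneg hlim
  calc ∫ t in Set.Ioi T, f t
      ≤ ∫ t in Set.Ioi T, K * -((1 / (t + 4) * t - (1 + log (t + 4)) * 1) / t ^ 2) := by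
        refine integral_mono_of_nonneg ?_ (hint.const_mul K) ?_
        · exact (ae_restrict_iff' measurableSet_Ioi).2 (.of_forall hf0)
        · refine (ae_restrict_iff' measurableSet_Ioi).2 (.of_forall fun t ht => ?_)
          exact (hf t ht).trans (mul_le_mul_of_nonneg_left (hlow t ht) hK)
    _ = K * ((1 + log (T + 4)) / T) := by
        rw [integral_const_mul, hval]
        ring

theorem log_one_add_mul_le_of_le_two_mul {y x : ℝ} (hy : 0 ≤ y) (hx : 1 ≤ x) (hyx : y ≤ 2 * x) :
    log (1 + 75.472 * y) ≤ 5.8 * x := by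
  have h1 : log (1 + 75.472 * y) ≤ log (2 ^ 8 * x) :=
    log_le_log (by positivity) (by linarith)
  rw [log_mul (by norm_num) (by linarith), log_pow] at h1
  have h2 := log_le_sub_one_of_pos (show 0 < x by linarith)
  have h3 := log_two_lt_d9
  push_cast at h1
  linarith

/-- for `T ≥ 1`, `∫_T^∞ t⁻² log ((1 + A3 L(t))^(2 r2)) dt
≤ c6 T⁻¹ log (e (T+4))` with `c6 = 11.605 r2² log (D N^(A0 (1-E0)))`. -/
theorem stmt_6
    (r2 : ℕ) (hr2 : 1 ≤ r2)
    (D N : ℝ) (hD : 9 ≤ D) (hN : 1 ≤ N)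
    (E0 : ℝ) (hE0 : E0 = 0 ∨ E0 = 1)
    (A0 A3 : ℝ) (hA0 : A0 = 0.7761) (hA3 : A3 = 75.472)
    (L : ℝ → ℝ)
    (hL : ∀ t : ℝ, L t = Real.log D + A0 * Real.log ((|t| + 1) ^ (2 * r2) * N ^ (1 - E0)))
    (c6 : ℝ) (hc6 : c6 = 11.605 * (r2 : ℝ) ^ 2 * Real.log (D * N ^ (A0 * (1 - E0))))
    (T : ℝ) (hT : 1 ≤ T) :
    (∫ t in Set.Ioi T, t ^ (-(2 : ℝ)) * (2 * r2 * Real.log (1 + A3 * L t))) ≤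
      c6 * T⁻¹ * Real.log (Real.exp 1 * (T + 4)) := by
  have hN0 : 0 < N := by linarith
  have hr : (1 : ℝ) ≤ r2 := by exact_mod_cast hr2
  obtain ⟨l, hl⟩ : ∃ l, l = log (D * N ^ (A0 * (1 - E0))) := ⟨_, rfl⟩
  have hl' : l = log D + A0 * ((1 - E0) * log N) := by
    rw [hl, log_mul (by linarith) (by positivity), log_rpow hN0, mul_assoc]
  have hl2 : 2 ≤ l := by
    have h1 : log (2 ^ 3) ≤ log D := log_le_log (by norm_num) (by linarith)
    rw [log_pow] at h1
    push_cast at h1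
    have h2 := log_two_gt_d9
    have h3 : 0 ≤ A0 * ((1 - E0) * log N) := by
      have := log_nonneg hN
      have : 0 ≤ 1 - E0 := by rcases hE0 with h | h <;> norm_num [h]
      rw [hA0]
      positivity
    linarith
  have hLt : ∀ t, T < t → L t = l + 1.5522 * (r2 * log (t + 1)) := by
    intro t ht
    have ht0 : 0 < t := by linarith
    rw [hL, abs_of_pos ht0, log_mul (by positivity) (by positivity), log_pow, log_rpow hN0, hl',
      hA0]
    push_cast
    ring
  have hlog1 : ∀ t, T < t → 0 ≤ log (t + 1) := fun t ht => log_nonneg (by linarith)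
  have hLnonneg : ∀ t, T < t → 0 ≤ L t := by
    intro t ht
    have := hlog1 t ht
    rw [hLt t ht]
    positivity
  have key : ∀ t, T < t → log (1 + A3 * L t) ≤ 5.8 * (r2 * l * log (t + 4)) := by
    intro t ht
    have h1 := hlog1 t ht
    have h14 : log (t + 1) ≤ log (t + 4) := log_le_log (by linarith) (by linarith)
    have h4 : 1 ≤ log (t + 4) := by
      rw [le_log_iff_exp_le (by linarith)]
      linarith [exp_one_lt_d9]
    have hrl : l ≤ r2 * l := le_mul_of_one_le_left (by linarith) hr
    have hx : r2 * l ≤ r2 * l * log (t + 4) := le_mul_of_one_le_right (by positivity) h4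
    have hy : 1.5522 * (r2 * log (t + 1)) ≤ r2 * l * log (t + 4) := by
      calc 1.5522 * (r2 * log (t + 1)) = r2 * 1.5522 * log (t + 1) := by ring
        _ ≤ r2 * l * log (t + 4) := by
          gcongr
          linarith
    rw [hA3]
    refine log_one_add_mul_le_of_le_two_mul (hLnonneg t ht) (by linarith) ?_
    rw [hLt t ht]
    linarith
  have hpow : ∀ t, T < t → t ^ (-(2 : ℝ)) = (t ^ 2)⁻¹ := by
    intro t ht
    rw [rpow_neg (by linarith), rpow_two]
  have main := setIntegral_Ioi_le_mul_one_add_log_div (K := c6) (T := T)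
    (f := fun t => t ^ (-(2 : ℝ)) * (2 * r2 * log (1 + A3 * L t)))
    (by rw [hc6, ← hl]; positivity) hT
    (fun t ht => by
      have h1 := hLnonneg t ht
      have h2 : 0 ≤ log (1 + A3 * L t) := log_nonneg (by rw [hA3]; linarith)
      have h3 : T < t := ht
      have h4 : 0 < t := by linarith
      positivity)
    (fun t ht => by
      have h3 : T < t := ht
      have h4 : 0 ≤ log (t + 4) := log_nonneg (by linarith)
      calc t ^ (-(2 : ℝ)) * (2 * r2 * log (1 + A3 * L t))
          ≤ (t ^ 2)⁻¹ * (2 * r2 * (5.8 * (r2 * l * log (t + 4)))) := by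
            rw [hpow t ht]
            gcongr
            exact key t ht
        _ = 11.6 * r2 ^ 2 * l * (log (t + 4) / t ^ 2) := by ring
        _ ≤ c6 * (log (t + 4) / t ^ 2) := by
            rw [hc6, ← hl]
            gcongr
            norm_num)
  rw [log_mul (exp_ne_zero 1) (by linarith), log_exp]
  calc _ ≤ _ := main
    _ = _ := by ring
end

section
/- For every real number T ≥ 1, ∫_T^∞ φ0(t)·t^(−2) dt ≤ c8·T^(−1)·log(e·(T+4)), where c8 = 1138.428·r2²·log( D·N^(5/8) ). -/
open Real MeasureTheory

theorem riemannZeta_re_bounds {s : ℝ} (hs : 1 < s) :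
    0 < (riemannZeta (s : ℂ)).re ∧ (riemannZeta (s : ℂ)).re ≤ s / (s - 1) := by
  have hsum : Summable fun n : ℕ => 1 / ((n : ℝ) + 1) ^ s := by
    have := (summable_nat_add_iff 1).mpr (Real.summable_one_div_nat_rpow.mpr hs)
    simpa using this
  have hz : riemannZeta (s : ℂ) = ((∑' n : ℕ, 1 / ((n : ℝ) + 1) ^ s : ℝ) : ℂ) := by
    rw [zeta_eq_tsum_one_div_nat_add_one_cpow (by simpa using hs), Complex.ofReal_tsum]
    refine tsum_congr fun n => ?_
    rw [Complex.ofReal_div, Complex.ofReal_cpow (by positivity)]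
    simp
  rw [hz, Complex.ofReal_re]
  refine ⟨hsum.tsum_pos (fun n => by positivity) 0 (by simp), ?_⟩
  have h := ZetaAsymptotics.zeta_limit_aux1 hs
  have hnn : 0 ≤ ZetaAsymptotics.termTSum s :=
    tsum_nonneg fun n => ZetaAsymptotics.term_nonneg _ _
  have hmul : 0 ≤ s * ZetaAsymptotics.termTSum s := mul_nonneg (by linarith) hnn
  have hdiv : s / (s - 1) = 1 + 1 / (s - 1) := by
    have : s - 1 ≠ 0 := by linarith
    field_simp
    ring
  linarith

theorem integral_Ioi_log_add_four {T : ℝ} (hT : 0 < T) :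
    IntegrableOn (fun t : ℝ => (Real.log (t + 4) + 4 / (t + 4)) * t ^ (-(2 : ℝ))) (Set.Ioi T) ∧
      ∫ t in Set.Ioi T, (Real.log (t + 4) + 4 / (t + 4)) * t ^ (-(2 : ℝ)) =
        T⁻¹ * Real.log (Real.exp 1 * (T + 4)) := by
  have hderiv : ∀ t ∈ Set.Ici T, HasDerivAt (fun t : ℝ => -((1 + Real.log (t + 4)) / t))
      ((Real.log (t + 4) + 4 / (t + 4)) * t ^ (-(2 : ℝ))) t := by
    intro t ht
    have ht0 : 0 < t := hT.trans_le ht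
    have h := (((((hasDerivAt_id t).add_const 4).log
      (by simp only [id]; linarith)).const_add 1).div (hasDerivAt_id t) ht0.ne').neg
    refine h.congr_deriv ?_
    rw [Real.rpow_neg ht0.le, Real.rpow_two]
    simp only [id]
    field_simp
    ring
  have hnonneg : ∀ t ∈ Set.Ioi T, 0 ≤ (Real.log (t + 4) + 4 / (t + 4)) * t ^ (-(2 : ℝ)) := by
    intro t ht
    have ht0 : 0 < t := hT.trans ht
    have := Real.log_nonneg (by linarith : (1 : ℝ) ≤ t + 4)
    positivity
  have hlim : Filter.Tendsto (fun t : ℝ => -((1 + Real.log (t + 4)) / t))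
      Filter.atTop (nhds 0) := by
    have hlog : Filter.Tendsto (fun t : ℝ => Real.log (t + 4) / t) Filter.atTop (nhds 0) := by
      have h := (Real.isLittleO_log_id_atTop.tendsto_div_nhds_zero).comp
        (Filter.tendsto_atTop_add_const_right Filter.atTop (4 : ℝ) Filter.tendsto_id)
      have h4 : Filter.Tendsto (fun t : ℝ => 1 + 4 * t⁻¹) Filter.atTop (nhds (1 + 4 * 0)) :=
        (tendsto_inv_atTop_zero.const_mul 4).const_add 1
      have h' := h.mul h4
      rw [zero_mul] at h'
      refine h'.congr' ?_
      filter_upwards [Filter.eventually_gt_atTop 0] with t ht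
      simp only [Function.comp, id]
      field_simp
    have h := (tendsto_inv_atTop_zero.add hlog).neg
    simp only [add_zero, neg_zero] at h
    refine h.congr fun t => ?_
    ring
  refine ⟨integrableOn_Ioi_deriv_of_nonneg' hderiv hnonneg hlim, ?_⟩
  rw [integral_Ioi_of_hasDerivAt_of_nonneg' hderiv hnonneg hlim,
    Real.log_mul (Real.exp_pos 1).ne' (by linarith), Real.log_exp]
  ring

theorem log_le_div_sub_one_add_log {x a : ℝ} (hx : 0 < x) (ha : 0 < a) :
    Real.log x ≤ x / a - 1 + Real.log a := by
  have h := Real.log_le_sub_one_of_pos (div_pos hx ha)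
  rw [Real.log_div hx.ne' ha.ne'] at h
  linarith

theorem log_five_bounds : 1.584 ≤ Real.log 5 ∧ Real.log 5 ≤ 1.618 := by
  have h1 : Real.log ((2 : ℝ) ^ 16) ≤ Real.log ((5 : ℝ) ^ 7) :=
    Real.log_le_log (by norm_num) (by norm_num)
  have h2 : Real.log ((5 : ℝ) ^ 3) ≤ Real.log ((2 : ℝ) ^ 7) :=
    Real.log_le_log (by norm_num) (by norm_num)
  rw [Real.log_pow, Real.log_pow] at h1 h2
  push_cast at h1 h2
  constructor <;> linarith [Real.log_two_gt_d9, Real.log_two_lt_d9]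

theorem log_nine_ge : 2.19 ≤ Real.log 9 := by
  have h1 : Real.log ((2 : ℝ) ^ 19) ≤ Real.log ((9 : ℝ) ^ 6) :=
    Real.log_le_log (by norm_num) (by norm_num)
  rw [Real.log_pow, Real.log_pow] at h1
  push_cast at h1
  linarith [Real.log_two_gt_d9]

theorem log_const_le : Real.log 75.472 ≤ 4.34 := by
  have h1 : Real.log ((75.472 : ℝ) ^ 4) ≤ Real.log ((2 : ℝ) ^ 25) :=
    Real.log_le_log (by norm_num) (by norm_num)
  rw [Real.log_pow, Real.log_pow] at h1
  push_cast at h1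
  linarith [Real.log_two_lt_d9]

/-- The inequality between the linear majorant of `φ0` and `c8 * log (t + 4)`, where `l`, `n`, `v`
stand for `log D`, `log N`, `log (t + 4)`. -/
theorem majorant_le {R l n v : ℝ} (hR : 1 ≤ R) (hl : 2.19 ≤ l) (hn : 0 ≤ n) (hv : 1.584 ≤ v) :
    32 * (((l + 1.5522 * R * v) / 4 - 1 + 1.3864) + v + R * 1.25 * v
        + 2 * R * ((1 + 75.472 * (l + 1.5522 * R * v)) / 256 - 1 + 5.5456))
      + 32 * (4.34 + 0.625 * (l + n) + 2 * R * 1.618)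
      + 8 * 75.472 * R * (l + 1.5522 * R * v) + 0.01 * R
      ≤ 1138.428 * R ^ 2 * (l + 0.625 * n) * v := by
  obtain ⟨a, rfl⟩ : ∃ a, R = 1 + a := ⟨R - 1, by ring⟩
  obtain ⟨b, rfl⟩ : ∃ b, l = 2.19 + b := ⟨l - 2.19, by ring⟩
  obtain ⟨c, rfl⟩ : ∃ c, v = 1.584 + c := ⟨v - 1.584, by ring⟩
  replace hR : 0 ≤ a := by linarith
  replace hl : 0 ≤ b := by linarith
  replace hv : 0 ≤ c := by linarith
  rw [← sub_nonneg]
  ring_nf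
  positivity

/-- for `T ≥ 1`, `∫_T^∞ φ0(t) t⁻² dt ≤ c8 T⁻¹ log (e (T+4))`
with `c8 = 1138.428 r2² log (D N^(5/8))` (principal-character case `E0 = 1`). -/
theorem stmt_7
    (r2 : ℕ) (hr2 : 1 ≤ r2)
    (D N : ℝ) (hD : 9 ≤ D) (hN : 1 ≤ N)
    (A0 A3 A4 η : ℝ)
    (hA0 : A0 = 0.7761) (hA3 : A3 = 75.472) (hA4 : A4 = 0.010) (hη : η = 1/4)
    (L : ℝ → ℝ)
    (hL : ∀ t : ℝ, L t = Real.log D + 2 * A0 * r2 * Real.log (|t| + 1))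
    (φ0 : ℝ → ℝ)
    (hφ0 : ∀ t : ℝ, φ0 t =
      32 * Real.log (L t * (|t| + 4) * (|t| + 2) ^ ((r2 : ℝ) * (1 + η))
          * (1 + A3 * L t) ^ (2 * r2))
      + 32 * Real.log (A3 * (D * N) ^ ((1 + η) / 2)
          * ((riemannZeta (1 + (η : ℂ))).re) ^ (2 * r2))
      + 8 * A3 * r2 * L t + A4 * r2 / L t)
    (c8 : ℝ) (hc8 : c8 = 1138.428 * (r2 : ℝ) ^ 2 * Real.log (D * N ^ ((5 : ℝ) / 8)))
    (T : ℝ) (hT : 1 ≤ T) :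
    (∫ t in Set.Ioi T, φ0 t * t ^ (-(2 : ℝ))) ≤
      c8 * T⁻¹ * Real.log (Real.exp 1 * (T + 4)) := by
  subst hA0 hA3 hA4 hη
  have hR : (1 : ℝ) ≤ r2 := by exact_mod_cast hr2
  have hl : 2.19 ≤ Real.log D := log_nine_ge.trans (Real.log_le_log (by norm_num) hD)
  have hn : 0 ≤ Real.log N := Real.log_nonneg hN
  have hD0 : 0 < D := by linarith
  have hN0 : 0 < N := by linarith
  have hc : c8 = 1138.428 * (r2 : ℝ) ^ 2 * (Real.log D + 0.625 * Real.log N) := by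
    rw [hc8, Real.log_mul hD0.ne' (by positivity), Real.log_rpow hN0]
    norm_num
  have hc0 : 0 ≤ c8 := by rw [hc]; positivity
  obtain ⟨hint, hval⟩ := integral_Ioi_log_add_four (by linarith : 0 < T)
  obtain ⟨hζ0, hζ⟩ := riemannZeta_re_bounds (s := 5 / 4) (by norm_num)
  have hcast : (1 : ℂ) + ((1 / 4 : ℝ) : ℂ) = ((5 / 4 : ℝ) : ℂ) := by push_cast; norm_num
  rw [hcast] at hφ0
  have hlogζ : Real.log (riemannZeta ((5 / 4 : ℝ) : ℂ)).re ≤ 1.618 :=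
    (Real.log_le_log hζ0 (hζ.trans (by norm_num))).trans log_five_bounds.2
  clear hcast hζ
  generalize (riemannZeta ((5 / 4 : ℝ) : ℂ)).re = z at *
  have hpoint : ∀ t : ℝ, 1 ≤ t → φ0 t ≤ c8 * Real.log (t + 4) := by
    intro t ht
    have hv : 1.584 ≤ Real.log (t + 4) :=
      log_five_bounds.1.trans (Real.log_le_log (by norm_num) (by linarith))
    have h1 : Real.log (t + 1) ≤ Real.log (t + 4) :=
      Real.log_le_log (by linarith) (by linarith)
    have h2 : Real.log (t + 2) ≤ Real.log (t + 4) :=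
      Real.log_le_log (by linarith) (by linarith)
    have h10 : 0 ≤ Real.log (t + 1) := Real.log_nonneg (by linarith)
    have hLt := hL t
    have hφt := hφ0 t
    rw [abs_of_nonneg (by linarith : 0 ≤ t)] at hLt hφt
    have hLlow : 1 ≤ L t := by
      have : 0 ≤ 2 * 0.7761 * (r2 : ℝ) * Real.log (t + 1) := by positivity
      linarith
    have hLup : L t ≤ Real.log D + 1.5522 * r2 * Real.log (t + 4) := by
      have := mul_le_mul_of_nonneg_left h1 (by positivity : 0 ≤ 1.5522 * (r2 : ℝ))
      linarith
    have hL0 : 0 < L t := by linarith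
    generalize L t = x at *
    have ht4 : 0 < t + 4 := by linarith
    have ht2 : 0 < t + 2 := by linarith
    rw [Real.log_mul (by positivity) (by positivity), Real.log_mul (by positivity) (by positivity),
      Real.log_mul (by positivity) (by positivity), Real.log_mul (by positivity) (by positivity),
      Real.log_mul (by positivity) (by positivity), Real.log_rpow ht2,
      Real.log_rpow (by positivity), Real.log_mul hD0.ne' hN0.ne', Real.log_pow,
      Real.log_pow] at hφt
    push_cast at hφt
    have e4 : Real.log 4 ≤ 1.3864 := by
      rw [show (4 : ℝ) = 2 ^ 2 by norm_num, Real.log_pow]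
      push_cast
      linarith [Real.log_two_lt_d9]
    have e256 : Real.log 256 ≤ 5.5456 := by
      rw [show (256 : ℝ) = 2 ^ 8 by norm_num, Real.log_pow]
      push_cast
      linarith [Real.log_two_lt_d9]
    have b1 := log_le_div_sub_one_add_log hL0 (by norm_num : (0 : ℝ) < 4)
    have b2 := log_le_div_sub_one_add_log (by positivity : 0 < 1 + 75.472 * x)
      (by norm_num : (0 : ℝ) < 256)
    have b3 := mul_le_mul_of_nonneg_left (b2.trans (add_le_add_right e256 _))
      (by positivity : 0 ≤ (r2 : ℝ))
    have b4 := mul_le_mul_of_nonneg_left h2 (by positivity : 0 ≤ (r2 : ℝ))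
    have b5 := mul_le_mul_of_nonneg_left hlogζ (by positivity : 0 ≤ (r2 : ℝ))
    have b6 := mul_le_mul_of_nonneg_left hLup (by positivity : 0 ≤ (r2 : ℝ))
    have b7 : 0.010 * (r2 : ℝ) / x ≤ 0.01 * r2 := by
      rw [div_le_iff₀ hL0]
      nlinarith
    have hm := majorant_le hR hl hn hv
    rw [hc]
    linarith [log_const_le]
  have hmono : ∀ t ∈ Set.Ioi T, φ0 t * t ^ (-(2 : ℝ)) ≤
      c8 * ((Real.log (t + 4) + 4 / (t + 4)) * t ^ (-(2 : ℝ))) := by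
    intro t ht
    have ht1 : 1 ≤ t := hT.trans (le_of_lt ht)
    rw [← mul_assoc]
    refine mul_le_mul_of_nonneg_right ((hpoint t ht1).trans ?_) (by positivity)
    have : 0 ≤ 4 / (t + 4) := by positivity
    gcongr
    linarith
  have hRHS : ∫ t in Set.Ioi T, c8 * ((Real.log (t + 4) + 4 / (t + 4)) * t ^ (-(2 : ℝ))) =
      c8 * T⁻¹ * Real.log (Real.exp 1 * (T + 4)) := by
    rw [integral_const_mul, hval, mul_assoc]
  rw [← hRHS]
  by_cases hf : IntegrableOn (fun t => φ0 t * t ^ (-(2 : ℝ))) (Set.Ioi T)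
  · exact setIntegral_mono_on hf (hint.const_mul c8) measurableSet_Ioi hmono
  · rw [integral_undef hf, hRHS, mul_assoc]
    have : 0 ≤ Real.log (Real.exp 1 * (T + 4)) :=
      Real.log_nonneg (by nlinarith [Real.add_one_le_exp 1])
    positivity
end

section
/- For every real number T ≥ 1, ∫_T^∞ φ(t)·t^(−2) dt ≤ c9·T^(−1)·log(e·(T+4)), where c9 = 821.212·r2²·log(D·N). -/
open Real MeasureTheory

/-- On the real half-line `s > 1`, the zeta function is at least `1`
and at most `1 + 1 / (s - 1)`. -/
theorem riemannZeta_re_mem_Icc {s : ℝ} (hs : 1 < s) :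
    (riemannZeta (s : ℂ)).re ∈ Set.Icc 1 (1 + 1 / (s - 1)) := by
  have hsum : (riemannZeta (s : ℂ)).re = ∑' n : ℕ, 1 / ((n : ℝ) + 1) ^ s := by
    rw [zeta_eq_tsum_one_div_nat_add_one_cpow (by simpa using hs), ← Complex.ofReal_re (∑' n : ℕ, _),
      Complex.ofReal_tsum]
    congr 2
    ext n
    rw [Complex.ofReal_div, Complex.ofReal_cpow (by positivity)]
    push_cast
    rfl
  have hsummable : Summable fun n : ℕ => 1 / ((n : ℝ) + 1) ^ s := by
    have := (summable_nat_add_iff 1).2 (Real.summable_one_div_nat_rpow.2 hs)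
    simpa using this
  rw [hsum]
  constructor
  · simpa using hsummable.le_tsum 0 (fun n _ => by positivity)
  · have haux := ZetaAsymptotics.zeta_limit_aux1 hs
    have hnonneg : 0 ≤ ZetaAsymptotics.termTSum s :=
      tsum_nonneg fun n => ZetaAsymptotics.term_nonneg (n + 1) s
    have : 0 ≤ s * ZetaAsymptotics.termTSum s := by positivity
    linarith

theorem hasDerivAt_neg_log_exp_mul_add_four_div {t : ℝ} (ht : 0 < t) :
    HasDerivAt (fun t => -(log (exp 1 * (t + 4)) / t))
      ((log (t + 4) + 4 / (t + 4)) * t ^ (-(2 : ℝ))) t := by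
  have hlog : HasDerivAt (fun t => log (exp 1 * (t + 4))) (exp 1 * 1 / (exp 1 * (t + 4))) t :=
    (((hasDerivAt_id t).add_const 4).const_mul (exp 1)).log (by positivity)
  refine (hlog.div (hasDerivAt_id t) ht.ne').neg.congr_deriv ?_
  rw [log_mul (exp_pos 1).ne' (by positivity), log_exp, rpow_neg ht.le, rpow_two]
  have := (exp_pos 1).ne'
  simp only [id]
  field_simp
  ring

theorem tendsto_neg_log_exp_mul_add_four_div :
    Filter.Tendsto (fun t : ℝ => -(log (exp 1 * (t + 4)) / t)) Filter.atTop (nhds 0) := by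
  have h := tendsto_pow_log_div_mul_add_atTop (exp 1)⁻¹ (-4) 1 (inv_ne_zero (exp_pos 1).ne')
  have hcomp : Filter.Tendsto (fun t : ℝ => exp 1 * (t + 4)) Filter.atTop Filter.atTop :=
    (Filter.tendsto_atTop_add_const_right _ 4 Filter.tendsto_id).const_mul_atTop (exp_pos 1)
  have h' := (h.comp hcomp).neg
  rw [neg_zero] at h'
  refine h'.congr fun t => ?_
  simp only [Function.comp, pow_one]
  rw [inv_mul_cancel_left₀ (exp_pos 1).ne']
  simp

/-- If `f ≤ c log (t + 4)` beyond `T > 0`, then `∫_T^∞ f(t) t⁻² dt ≤ c T⁻¹ log (e (T + 4))`. -/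
theorem integral_Ioi_mul_rpow_neg_two_le {f : ℝ → ℝ} {c T : ℝ} (hc : 0 ≤ c) (hT : 0 < T)
    (hf : ∀ t, T < t → f t ≤ c * log (t + 4)) :
    (∫ t in Set.Ioi T, f t * t ^ (-(2 : ℝ))) ≤ c * T⁻¹ * log (exp 1 * (T + 4)) := by
  have hlogT : 0 ≤ log (exp 1 * (T + 4)) :=
    log_nonneg (by nlinarith [add_one_le_exp (1 : ℝ)])
  by_cases hint : IntegrableOn (fun t => f t * t ^ (-(2 : ℝ))) (Set.Ioi T)
  · have hderiv : ∀ t ∈ Set.Ici T, HasDerivAt (fun t => -(log (exp 1 * (t + 4)) / t))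
        ((log (t + 4) + 4 / (t + 4)) * t ^ (-(2 : ℝ))) t := fun t ht =>
      hasDerivAt_neg_log_exp_mul_add_four_div (hT.trans_le ht)
    have hnonneg : ∀ t ∈ Set.Ioi T, 0 ≤ (log (t + 4) + 4 / (t + 4)) * t ^ (-(2 : ℝ)) := by
      intro t ht
      have ht0 : 0 < t := hT.trans ht
      have := log_nonneg (show 1 ≤ t + 4 by linarith)
      positivity
    calc (∫ t in Set.Ioi T, f t * t ^ (-(2 : ℝ)))
        ≤ ∫ t in Set.Ioi T, c * ((log (t + 4) + 4 / (t + 4)) * t ^ (-(2 : ℝ))) := by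
          refine setIntegral_mono_on hint ((integrableOn_Ioi_deriv_of_nonneg' hderiv hnonneg
            tendsto_neg_log_exp_mul_add_four_div).const_mul c) measurableSet_Ioi fun t ht => ?_
          have ht0 : 0 < t := hT.trans ht
          rw [← mul_assoc]
          gcongr
          refine (hf t ht).trans ?_
          gcongr
          have : 0 < 4 / (t + 4) := by positivity
          linarith
      _ = c * T⁻¹ * log (exp 1 * (T + 4)) := by
          rw [integral_const_mul, integral_Ioi_of_hasDerivAt_of_nonneg' hderiv hnonneg
            tendsto_neg_log_exp_mul_add_four_div]
          ring
  · rw [integral_undef hint]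
    positivity

theorem quadratic_bound_of_le {r X M : ℝ} (hr : 1 ≤ r) (hX : 2 ≤ X) (hM : 1.6 ≤ M) :
    320 * (r * X) + 490 * (r ^ 2 * M) + 450 * r + 48 * (r * M) + 24 * X + 60 ≤
      821.212 * (r ^ 2 * X * M) := by
  have hr_sq : r ≤ r ^ 2 := by nlinarith
  have hP1 : 1.6 * (r * X) ≤ r ^ 2 * X * M := by
    calc 1.6 * (r * X) = r * X * 1.6 := by ring
      _ ≤ r ^ 2 * X * M := by gcongr
  have hP2 : 2 * (r ^ 2 * M) ≤ r ^ 2 * X * M := by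
    calc 2 * (r ^ 2 * M) = r ^ 2 * 2 * M := by ring
      _ ≤ r ^ 2 * X * M := by gcongr
  have hP3 : r * M ≤ r ^ 2 * M := by gcongr
  have hP4 : 2 * r ≤ r * X := by nlinarith
  have hP5 : X ≤ r * X := by nlinarith
  linarith

/-- for `T ≥ 1`, `∫_T^∞ φ(t) t⁻² dt ≤ c9 T⁻¹ log (e (T+4))`
with `c9 = 821.212 r2² log (D N)` (non-principal case `E0 = 0`). -/
theorem stmt_8
    (r2 : ℕ) (hr2 : 1 ≤ r2)
    (D N : ℝ) (hD : 9 ≤ D) (hN : 1 ≤ N)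
    (εχ : ℝ) (hεχ : εχ = 0 ∨ εχ = 1)
    (A0 A3 A4 η : ℝ)
    (hA0 : A0 = 0.7761) (hA3 : A3 = 75.472) (hA4 : A4 = 0.010) (hη : η = 1/4)
    (A : ℝ) (hA : A = (2 * π) ^ (-(r2 : ℝ)) * Real.sqrt (D * N))
    (L : ℝ → ℝ)
    (hL : ∀ t : ℝ, L t = Real.log D + A0 * Real.log ((|t| + 1) ^ (2 * r2) * N))
    (φ : ℝ → ℝ)
    (hφ : ∀ t : ℝ, φ t =
      32 * Real.log ((1 + A3 * L t) ^ (2 * r2) * (|t| + 2) ^ ((r2 : ℝ) * (1 + 2 * η)))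
      + 32 * Real.log (1.4 * (1 + εχ) * A ^ (1 + 2 * η)
          * ((riemannZeta (1 + (η : ℂ))).re) ^ (2 * r2))
      + 4 * A3 * r2 * L t + A4 * r2 / L t)
    (c9 : ℝ) (hc9 : c9 = 821.212 * (r2 : ℝ) ^ 2 * Real.log (D * N))
    (T : ℝ) (hT : 1 ≤ T) :
    (∫ t in Set.Ioi T, φ t * t ^ (-(2 : ℝ))) ≤
      c9 * T⁻¹ * Real.log (Real.exp 1 * (T + 4)) := by
  have hr : (1 : ℝ) ≤ r2 := by exact_mod_cast hr2
  have hlogN : 0 ≤ log N := log_nonneg hN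
  have hDN : log (D * N) = log D + log N := log_mul (by positivity) (by positivity)
  have hlogD : 2 ≤ log D := by
    have h9 : log 9 = 2 * log 3 := by
      rw [show (9 : ℝ) = 3 ^ 2 by norm_num, log_pow]; norm_num
    have := log_le_log (by norm_num) hD
    linarith [log_three_gt_d9]
  have hX : 2 ≤ log (D * N) := by linarith
  rw [hc9]
  refine integral_Ioi_mul_rpow_neg_two_le (by positivity) (by positivity) fun t ht => ?_
  have ht1 : 1 < t := hT.trans_lt ht
  have hlog5 := abs_le.1 log_five_near_10
  have hM : 1.6 ≤ log (t + 4) := by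
    have := log_le_log (by norm_num) (show (5 : ℝ) ≤ t + 4 by linarith)
    linarith
  have hM1 : log (t + 1) ≤ log (t + 4) := log_le_log (by linarith) (by linarith)
  have hM2 : log (t + 2) ≤ log (t + 4) := log_le_log (by linarith) (by linarith)
  have hM0 : 0 ≤ log (t + 1) := log_nonneg (by linarith)
  have hrM : r2 * log (t + 1) ≤ r2 * log (t + 4) := by gcongr
  have hrM0 : 0 ≤ r2 * log (t + 1) := by positivity
  have hrM2 : r2 * log (t + 2) ≤ r2 * log (t + 4) := by gcongr
  have hLt : L t = log D + 0.7761 * (2 * (r2 * log (t + 1)) + log N) := by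
    rw [hL, hA0, abs_of_pos (by linarith), log_mul (by positivity) (by positivity), log_pow]
    push_cast
    ring
  have hL2 : 2 ≤ L t := by rw [hLt]; linarith
  have hLle : L t ≤ log (D * N) + 1.5522 * (r2 * log (t + 4)) := by rw [hLt]; linarith
  have hlogL : log (1 + 75.472 * L t) ≤ (1 + 75.472 * L t) / 512 + 5.24 := by
    have hpos : 0 < 1 + 75.472 * L t := by linarith
    have h512 : log 512 = 9 * log 2 := by
      rw [show (512 : ℝ) = 2 ^ 9 by norm_num, log_pow]; norm_num
    have := log_le_sub_one_of_pos (show 0 < (1 + 75.472 * L t) / 512 by positivity)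
    rw [log_div hpos.ne' (by norm_num), h512] at this
    linarith [log_two_lt_d9]
  have hApos : 0 < A := by rw [hA]; positivity
  have hlogA : log A ≤ log (D * N) / 2 := by
    rw [hA, log_mul (by positivity) (by positivity), log_sqrt (by positivity),
      log_rpow (by positivity)]
    have := log_nonneg (show 1 ≤ 2 * π by linarith [pi_gt_three])
    have : 0 ≤ r2 * log (2 * π) := by positivity
    linarith
  obtain ⟨hz1, hz5⟩ := riemannZeta_re_mem_Icc (show (1 : ℝ) < 5 / 4 by norm_num)
  have hzarg : (1 + (η : ℂ)) = ((5 / 4 : ℝ) : ℂ) := by rw [hη]; push_cast; norm_num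
  rw [← hzarg] at hz1 hz5
  have hlogz : log (riemannZeta (1 + (η : ℂ))).re ≤ 1.61 := by
    have := log_le_log (by linarith) (hz5.trans (show _ ≤ (5 : ℝ) by norm_num))
    linarith
  have hfirst : log ((1 + A3 * L t) ^ (2 * r2) * (|t| + 2) ^ ((r2 : ℝ) * (1 + 2 * η))) ≤
      2 * (r2 * ((1 + 75.472 * L t) / 512 + 5.24)) + 1.5 * (r2 * log (t + 4)) := by
    rw [hA3, hη, abs_of_pos (by linarith), log_mul (by positivity) (by positivity), log_pow,
      log_rpow (by positivity)]
    have : r2 * log (1 + 75.472 * L t) ≤ r2 * ((1 + 75.472 * L t) / 512 + 5.24) := by gcongr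
    push_cast
    linarith
  have hsecond : log (1.4 * (1 + εχ) * A ^ (1 + 2 * η)
      * ((riemannZeta (1 + (η : ℂ))).re) ^ (2 * r2)) ≤
      1.8 + 0.75 * log (D * N) + 3.22 * r2 := by
    have hε : 0 < 1.4 * (1 + εχ) ∧ 1.4 * (1 + εχ) ≤ 2.8 := by
      rcases hεχ with rfl | rfl <;> norm_num
    have hlogε := log_le_sub_one_of_pos hε.1
    have hε0 := hε.1
    have hz0 : 0 < (riemannZeta (1 + (η : ℂ))).re := by linarith
    rw [log_mul (by positivity) (by positivity), log_mul hε0.ne' (by positivity), log_pow,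
      log_rpow hApos]
    have hrz : r2 * log (riemannZeta (1 + (η : ℂ))).re ≤ r2 * 1.61 := by gcongr
    have hηA : (1 + 2 * η) * log A = 1.5 * log A := by rw [hη]; norm_num
    push_cast
    linarith [hε.2]
  have hquot : A4 * r2 / L t ≤ 0.005 * r2 := by
    rw [hA4, div_le_iff₀ (by linarith)]
    nlinarith
  have hrL : r2 * L t ≤ r2 * log (D * N) + 1.5522 * (r2 ^ 2 * log (t + 4)) := by
    calc r2 * L t ≤ r2 * (log (D * N) + 1.5522 * (r2 * log (t + 4))) := by gcongr
      _ = _ := by ring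
  rw [hφ]
  have hA3L : 4 * A3 * r2 * L t = 301.888 * (r2 * L t) := by rw [hA3]; ring
  rw [hA3L]
  have hbound := quadratic_bound_of_le hr hX hM
  have hrX0 : 0 ≤ r2 * log (D * N) := by positivity
  have hrsqM0 : 0 ≤ (r2 : ℝ) ^ 2 * log (t + 4) := by positivity
  linarith
end

section
/- For every real number σ with 1 < σ ≤ 2, one has −ζ′(σ)/ζ(σ) < 1/(σ − 1) − γ + C1·(σ − 1), where C1 = 0.1875463, ζ is the Riemann zeta function, ζ′ its derivative, and γ is the Euler–Mascheroni constant. (For real σ > 1 the quantity ζ′(σ)/ζ(σ) is real, so the inequality is between real numbers.) -/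
open Real Complex
open Filter Topology

theorem nonpos_of_hasDerivAt_nonpos {g g' : ℝ → ℝ} {a b : ℝ} (ha : g a ≤ 0)
    (hg : ∀ x ∈ Set.Icc a b, HasDerivAt g (g' x) x) (hg' : ∀ x ∈ Set.Icc a b, g' x ≤ 0) :
    ∀ x ∈ Set.Icc a b, g x ≤ 0 := by
  intro x hx
  have h := antitoneOn_of_hasDerivWithinAt_nonpos (convex_Icc a b)
    (fun y hy => (hg y hy).continuousAt.continuousWithinAt)
    (fun y hy => (hg y (interior_subset hy)).hasDerivWithinAt)
    (fun y hy => hg' y (interior_subset hy))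
  exact (h (Set.left_mem_Icc.2 (hx.1.trans hx.2)) hx hx.1).trans ha

/-- The trapezoidal rule with its first Euler-Maclaurin correction. -/
theorem trapezoid_sub_integral_le {F f f₁ f₂ f₃ f₄ : ℝ → ℝ} {a : ℝ}
    (hF : ∀ x, a ≤ x → HasDerivAt F (f x) x) (h₁ : ∀ x, a ≤ x → HasDerivAt f (f₁ x) x)
    (h₂ : ∀ x, a ≤ x → HasDerivAt f₁ (f₂ x) x) (h₃ : ∀ x, a ≤ x → HasDerivAt f₂ (f₃ x) x)
    (h₄ : ∀ x, a ≤ x → HasDerivAt f₃ (f₄ x) x) (hnn : ∀ x, a ≤ x → 0 ≤ f₄ x) :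
    (f a + f (a + 1)) / 2 - (F (a + 1) - F a) ≤ (f₁ (a + 1) - f₁ a) / 12 := by
  have hid : ∀ x : ℝ, HasDerivAt (fun y => y - a) 1 x := fun x => (hasDerivAt_id x).sub_const a
  have e₃ : ∀ x ∈ Set.Icc a (a + 1),
      (f₁ a - f₁ x) / 6 + (x - a) / 6 * f₂ x - (x - a) ^ 2 / 12 * f₃ x ≤ 0 := by
    refine nonpos_of_hasDerivAt_nonpos (g' := fun x => -((x - a) ^ 2 / 12 * f₄ x)) (by simp) ?_ ?_
    · intro x hx
      refine (((((h₂ x hx.1).const_sub (f₁ a)).div_const 6).add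
        (((hid x).div_const 6).mul (h₃ x hx.1))).sub
        ((((hid x).pow 2).div_const 12).mul (h₄ x hx.1))).congr_deriv ?_
      simp; ring
    · intro x hx
      have := hnn x hx.1
      simp only [Left.neg_nonpos_iff]; positivity
  have e₂ : ∀ x ∈ Set.Icc a (a + 1),
      (f a - f x) / 2 + (x - a) / 3 * f₁ x + (x - a) / 6 * f₁ a - (x - a) ^ 2 / 12 * f₂ x ≤ 0 := by
    refine nonpos_of_hasDerivAt_nonpos (by simp) ?_ e₃
    intro x hx
    refine ((((((h₁ x hx.1).const_sub (f a)).div_const 2).add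
      (((hid x).div_const 3).mul (h₂ x hx.1))).add (((hid x).div_const 6).mul_const (f₁ a))).sub
      ((((hid x).pow 2).div_const 12).mul (h₃ x hx.1))).congr_deriv ?_
    simp; ring
  have e₁ : ∀ x ∈ Set.Icc a (a + 1),
      (x - a) / 2 * (f a + f x) - (F x - F a) - (x - a) ^ 2 / 12 * (f₁ x - f₁ a) ≤ 0 := by
    refine nonpos_of_hasDerivAt_nonpos (by simp) ?_ e₂
    intro x hx
    refine (((((hid x).div_const 2).mul ((h₁ x hx.1).const_add (f a))).sub
      ((hF x hx.1).sub_const (F a))).sub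
      ((((hid x).pow 2).div_const 12).mul ((h₂ x hx.1).sub_const (f₁ a)))).congr_deriv ?_
    simp; ring
  have := e₁ (a + 1) ⟨by linarith, le_rfl⟩
  simp only [add_sub_cancel_left] at this
  linarith

/-- The trapezoidal rule for a function whose derivative is a difference of monotone functions. -/
theorem le_trapezoid_sub_integral {F f f₁ ψ W : ℝ → ℝ} {a : ℝ}
    (hF : ∀ x, a ≤ x → HasDerivAt F (f x) x) (h₁ : ∀ x, a ≤ x → HasDerivAt f (f₁ x) x)
    (hf : ∀ x, a ≤ x → f₁ x = ψ x - W x) (hψ : MonotoneOn ψ (Set.Ici a))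
    (hW : MonotoneOn W (Set.Ici a)) :
    -(W (a + 1) - W a) / 8 ≤ (f a + f (a + 1)) / 2 - (F (a + 1) - F a) := by
  have hid : ∀ c x : ℝ, HasDerivAt (fun y => y - c) 1 x := fun c x => (hasDerivAt_id x).sub_const c
  set c := a + 1 / 2 with hc
  set b := a + 1 with hb
  set p := ψ c - W a with hp
  set q := ψ c - W b with hq
  have hac : a ≤ c := by linarith
  have hcb : c ≤ b := by linarith
  have l₁ : ∀ x ∈ Set.Icc a c, f x - f a - p * (x - a) ≤ 0 := by
    refine nonpos_of_hasDerivAt_nonpos (g' := fun x => f₁ x - p) (by simp) ?_ ?_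
    · intro x hx
      exact (((h₁ x hx.1).sub_const (f a)).sub ((hid a x).const_mul p)).congr_deriv (by simp)
    · intro x hx
      have := hψ hx.1 hac hx.2
      have := hW (Set.mem_Ici.2 le_rfl) hx.1 hx.1
      rw [hf x hx.1]; linarith
  have l₂ : ∀ x ∈ Set.Icc a c, F x - F a - f a * (x - a) - p / 2 * (x - a) ^ 2 ≤ 0 := by
    refine nonpos_of_hasDerivAt_nonpos (by simp) ?_ l₁
    intro x hx
    refine ((((hF x hx.1).sub_const (F a)).sub ((hid a x).const_mul (f a))).sub
      (((hid a x).pow 2).const_mul (p / 2))).congr_deriv ?_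
    simp; ring
  have r₁ : ∀ x ∈ Set.Icc c b, f x ≤ f b - q * (b - x) := by
    intro x hx
    have hm : MonotoneOn (fun y => f y - q * y) (Set.Icc c b) := by
      refine monotoneOn_of_hasDerivWithinAt_nonneg (f' := fun y => f₁ y - q) (convex_Icc c b) ?_ ?_ ?_
      · intro y hy
        exact ((h₁ y (hac.trans hy.1)).sub
          ((hasDerivAt_id y).const_mul q)).continuousAt.continuousWithinAt
      · intro y hy
        have hy := interior_subset hy
        exact (((h₁ y (hac.trans hy.1)).sub ((hasDerivAt_id y).const_mul q)).congr_deriv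
          (by simp)).hasDerivWithinAt
      · intro y hy
        have hy := interior_subset hy
        have hay := hac.trans hy.1
        have := hψ hac hay hy.1
        have := hW hay (hac.trans hcb) hy.2
        rw [hf y hay]; linarith
    have := hm hx ⟨hcb, le_rfl⟩ hx.2
    simp only at this
    linarith
  have r₂ : ∀ x ∈ Set.Icc c b,
      F x - F c - f b * (x - c) - q / 2 * (b - x) ^ 2 + q / 8 ≤ 0 := by
    refine nonpos_of_hasDerivAt_nonpos (g' := fun x => f x - f b + q * (b - x)) ?_ ?_ ?_
    · have : b - c = 1 / 2 := by rw [hb, hc]; ring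
      rw [this]; apply le_of_eq; ring
    · intro x hx
      refine (((((hF x (hac.trans hx.1)).sub_const (F c)).sub ((hid c x).const_mul (f b))).sub
        ((((hasDerivAt_id x).const_sub b).pow 2).const_mul (q / 2))).add_const (q / 8)).congr_deriv ?_
      simp; ring
    · intro x hx
      have := r₁ x hx
      linarith
  have t₁ := l₂ c ⟨hac, le_rfl⟩
  have t₂ := r₂ b ⟨hcb, le_rfl⟩
  have d₁ : c - a = 1 / 2 := by rw [hc]; ring
  have d₂ : b - c = 1 / 2 := by rw [hb, hc]; ring
  rw [d₁] at t₁
  rw [d₂] at t₂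
  linarith

/-- The function `x ↦ (A + B log x + C log² x) x⁻ᵃ`, a class closed under differentiation. -/
noncomputable def logQuadRpow (A B C a x : ℝ) : ℝ :=
  (A + B * Real.log x + C * Real.log x ^ 2) * x ^ (-a)

theorem hasDerivAt_logQuadRpow (A B C a : ℝ) {x : ℝ} (hx : 0 < x) :
    HasDerivAt (logQuadRpow A B C a)
      (logQuadRpow (B - a * A) (2 * C - a * B) (-(a * C)) (a + 1) x) x := by
  have hl := Real.hasDerivAt_log hx.ne'
  have hp := Real.hasDerivAt_rpow_const (p := -a) (Or.inl hx.ne')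
  refine ((((hl.const_mul B).const_add A).add ((hl.pow 2).const_mul C)).mul hp).congr_deriv ?_
  have e : x ^ (-a - 1) = x ^ (-a) * x⁻¹ := by
    rw [sub_eq_add_neg, Real.rpow_add hx, Real.rpow_neg_one]
  have e' : -(a + 1) = -a - 1 := by ring
  simp only [logQuadRpow, e', e, Pi.add_apply, Pi.pow_apply]
  simp
  ring

theorem logQuadRpow_eq_exp (A B C a : ℝ) {x : ℝ} (hx : 0 < x) :
    logQuadRpow A B C a x =
      (A + B * Real.log x + C * Real.log x ^ 2) * Real.exp (-(a * Real.log x)) := by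
  rw [logQuadRpow, Real.rpow_def_of_pos hx]
  ring_nf

theorem tendsto_logQuadRpow_atTop (A B C : ℝ) {a : ℝ} (ha : 0 < a) :
    Tendsto (logQuadRpow A B C a) atTop (𝓝 0) := by
  have h (n : ℕ) : Tendsto (fun u : ℝ => u ^ n * Real.exp (-(a * u))) atTop (𝓝 0) := by
    simpa using tendsto_rpow_mul_exp_neg_mul_atTop_nhds_zero n a ha
  have h' := ((((h 0).const_mul A).add ((h 1).const_mul B)).add ((h 2).const_mul C)).comp
    Real.tendsto_log_atTop
  simp only [mul_zero, add_zero] at h'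
  refine h'.congr' ?_
  filter_upwards [eventually_gt_atTop 0] with x hx
  rw [logQuadRpow_eq_exp _ _ _ _ hx]
  simp; ring

/-- One-sided Euler-Maclaurin summation up to the first Bernoulli correction. -/
theorem limit_le_eulerMaclaurin {F f f₁ f₂ f₃ f₄ : ℝ → ℝ} {N : ℕ} {ℓ : ℝ}
    (hF : ∀ x : ℝ, N ≤ x → HasDerivAt F (f x) x) (h₁ : ∀ x : ℝ, N ≤ x → HasDerivAt f (f₁ x) x)
    (h₂ : ∀ x : ℝ, N ≤ x → HasDerivAt f₁ (f₂ x) x) (h₃ : ∀ x : ℝ, N ≤ x → HasDerivAt f₂ (f₃ x) x)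
    (h₄ : ∀ x : ℝ, N ≤ x → HasDerivAt f₃ (f₄ x) x) (hnn : ∀ x : ℝ, N ≤ x → 0 ≤ f₄ x)
    (hf : Tendsto f atTop (𝓝 0)) (hf₁ : Tendsto f₁ atTop (𝓝 0))
    (hℓ : Tendsto (fun M : ℕ => ∑ n ∈ Finset.range (M + 1), f n - F M) atTop (𝓝 ℓ)) :
    ℓ ≤ ∑ n ∈ Finset.range (N + 1), f n - F N - f N / 2 - f₁ N / 12 := by
  have hc := tendsto_natCast_atTop_atTop (R := ℝ)
  have hlim := (hℓ.sub ((hf.comp hc).div_const 2)).sub ((hf₁.comp hc).div_const 12)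
  simp only [zero_div, sub_zero] at hlim
  refine le_of_tendsto hlim ?_
  filter_upwards [eventually_ge_atTop N] with M hM
  induction M, hM using Nat.le_induction with
  | base => exact le_rfl
  | succ M hM ih =>
    have hN : (N : ℝ) ≤ M := by exact_mod_cast hM
    have := trapezoid_sub_integral_le (fun x hx => hF x (hN.trans hx))
      (fun x hx => h₁ x (hN.trans hx)) (fun x hx => h₂ x (hN.trans hx))
      (fun x hx => h₃ x (hN.trans hx)) (fun x hx => h₄ x (hN.trans hx))
      (fun x hx => hnn x (hN.trans hx))
    rw [Finset.sum_range_succ]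
    simp only [Function.comp_apply] at ih ⊢
    push_cast
    linarith

/-- Lower bound for a sum by the integral when the derivative has bounded decrease. -/
theorem le_limit_of_decrease_le {F f f₁ ψ W : ℝ → ℝ} {N : ℕ} {ℓ V : ℝ}
    (hF : ∀ x : ℝ, N ≤ x → HasDerivAt F (f x) x) (h₁ : ∀ x : ℝ, N ≤ x → HasDerivAt f (f₁ x) x)
    (hψW : ∀ x : ℝ, N ≤ x → f₁ x = ψ x - W x) (hψ : MonotoneOn ψ (Set.Ici N))
    (hW : MonotoneOn W (Set.Ici N)) (hV : ∀ x : ℝ, N ≤ x → W x - W N ≤ V)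
    (hf : Tendsto f atTop (𝓝 0))
    (hℓ : Tendsto (fun M : ℕ => ∑ n ∈ Finset.range (M + 1), f n - F M) atTop (𝓝 ℓ)) :
    ∑ n ∈ Finset.range (N + 1), f n - F N - f N / 2 - V / 8 ≤ ℓ := by
  have hlim := hℓ.sub ((hf.comp (tendsto_natCast_atTop_atTop (R := ℝ))).div_const 2)
  simp only [zero_div, sub_zero] at hlim
  refine ge_of_tendsto hlim ?_
  filter_upwards [eventually_ge_atTop N] with M hM
  suffices h : ∑ n ∈ Finset.range (N + 1), f n - F N - f N / 2 - (W M - W N) / 8 ≤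
      ∑ n ∈ Finset.range (M + 1), f n - F M - f M / 2 by
    have := hV M (by exact_mod_cast hM)
    simp only [Function.comp_apply]
    linarith
  induction M, hM using Nat.le_induction with
  | base => simp
  | succ M hM ih =>
    have hN : (N : ℝ) ≤ M := by exact_mod_cast hM
    have hs := Set.Ici_subset_Ici.2 hN
    have := le_trapezoid_sub_integral (fun x hx => hF x (hN.trans hx))
      (fun x hx => h₁ x (hN.trans hx)) (fun x hx => hψW x (hN.trans hx))
      (hψ.mono hs) (hW.mono hs)
    rw [Finset.sum_range_succ _ (M + 1)]
    push_cast
    linarith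

/-- The real function `σ ↦ ∑ logᵏ n / n^σ`, that is `(-1)ᵏ` times the `k`-th derivative of `ζ`. -/
noncomputable def zetaLogSum (k : ℕ) (σ : ℝ) : ℝ := (LSeries (LSeries.logMul^[k] 1) σ).re

theorem abscissa_lt_of_one_lt (k : ℕ) {σ : ℝ} (hσ : 1 < σ) :
    LSeries.abscissaOfAbsConv (LSeries.logMul^[k] 1) < (σ : ℂ).re := by
  rw [LSeries.absicssaOfAbsConv_logPowMul, LSeries.abscissaOfAbsConv_one]
  simpa using (by exact_mod_cast hσ : (1 : EReal) < σ)

theorem hasDerivAt_zetaLogSum (k : ℕ) {σ : ℝ} (hσ : 1 < σ) :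
    HasDerivAt (zetaLogSum k) (-zetaLogSum (k + 1) σ) σ := by
  have h := (LSeries_hasDerivAt (abscissa_lt_of_one_lt k hσ)).real_of_complex
  unfold zetaLogSum
  rw [Function.iterate_succ_apply']
  simpa using h

theorem logMul_iterate_one (k n : ℕ) :
    (LSeries.logMul^[k] 1) n = ((Real.log n ^ k : ℝ) : ℂ) := by
  induction k with
  | zero => simp
  | succ k ih =>
    rw [Function.iterate_succ_apply', LSeries.logMul, ih, ← Complex.natCast_log]
    push_cast; ring

theorem term_logMul_iterate_one (k : ℕ) {σ : ℝ} (hσ : 1 < σ) (n : ℕ) :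
    LSeries.term (LSeries.logMul^[k] 1) σ n =
      ((Real.log n ^ k * (n : ℝ) ^ (-σ) : ℝ) : ℂ) := by
  rcases eq_or_ne n 0 with rfl | hn
  · simp [Real.zero_rpow (neg_ne_zero.2 (by linarith : σ ≠ 0))]
  · rw [LSeries.term_of_ne_zero hn, logMul_iterate_one, Real.rpow_neg n.cast_nonneg,
      Complex.ofReal_mul, Complex.ofReal_inv, Complex.ofReal_cpow n.cast_nonneg, div_eq_mul_inv]
    simp

theorem tendsto_zetaLogSum (k : ℕ) {σ : ℝ} (hσ : 1 < σ) :
    Tendsto (fun M : ℕ => ∑ n ∈ Finset.range (M + 1), Real.log n ^ k * (n : ℝ) ^ (-σ)) atTop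
      (𝓝 (zetaLogSum k σ)) := by
  have h := (LSeriesSummable_of_abscissaOfAbsConv_lt_re (abscissa_lt_of_one_lt k hσ)).LSeriesHasSum
  have h' := Complex.hasSum_re h
  simp only [term_logMul_iterate_one k hσ, Complex.ofReal_re] at h'
  exact h'.tendsto_sum_nat.comp (tendsto_add_atTop_nat 1)

theorem neg_deriv_div_riemannZeta_re {σ : ℝ} (hσ : 1 < σ) :
    ((-(deriv riemannZeta (σ : ℂ))) / riemannZeta (σ : ℂ)).re =
      zetaLogSum 1 σ / zetaLogSum 0 σ := by
  have hre (k : ℕ) : LSeries (LSeries.logMul^[k] 1) σ = (zetaLogSum k σ : ℂ) := by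
    apply Complex.ext
    · simp [zetaLogSum]
    · have h := Complex.hasSum_im (LSeriesSummable_of_abscissaOfAbsConv_lt_re
        (abscissa_lt_of_one_lt k hσ)).LSeriesHasSum
      simp only [term_logMul_iterate_one k hσ, Complex.ofReal_im] at h
      simpa using h.unique hasSum_zero
  have h0 : riemannZeta σ = zetaLogSum 0 σ := by
    rw [← hre, ← LSeries_one_eq_riemannZeta (by simpa using hσ)]
    rfl
  have h1 : deriv riemannZeta σ = -(zetaLogSum 1 σ : ℂ) := by
    have : riemannZeta =ᶠ[𝓝 (σ : ℂ)] LSeries 1 := by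
      filter_upwards [(isOpen_lt continuous_const Complex.continuous_re).mem_nhds
        (show 1 < (σ : ℂ).re by simpa using hσ)] with s hs
      exact (LSeries_one_eq_riemannZeta hs).symm
    rw [this.deriv_eq, ← hre]
    exact LSeries_deriv (abscissa_lt_of_one_lt 0 hσ)
  rw [h0, h1, neg_neg, ← Complex.ofReal_div, Complex.ofReal_re]

theorem tendsto_zetaLogSum_zero_sub :
    Tendsto (fun s : ℝ => zetaLogSum 0 (1 + s) - 1 / s) (𝓝[>] 0)
      (𝓝 Real.eulerMascheroniConstant) := by
  have h := (Complex.continuous_re.tendsto _).comp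
    ZetaAsymptotics.tendsto_riemannZeta_sub_one_div_nhds_right
  have hs : Tendsto (fun s : ℝ => 1 + s) (𝓝[>] 0) (𝓝[>] 1) := by
    refine tendsto_nhdsWithin_of_tendsto_nhds_of_eventually_within _ ?_ ?_
    · have : Tendsto (fun s : ℝ => 1 + s) (𝓝 0) (𝓝 (1 + 0)) := by
        exact (continuous_const.add continuous_id).tendsto 0
      simpa using this.mono_left nhdsWithin_le_nhds
    · filter_upwards [self_mem_nhdsWithin] with s hs
      simpa using hs
  refine (h.comp hs).congr' ?_
  filter_upwards [self_mem_nhdsWithin] with s hs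
  have hs : 0 < s := hs
  have : riemannZeta ((1 + s : ℝ) : ℂ) = LSeries 1 ((1 + s : ℝ) : ℂ) :=
    (LSeries_one_eq_riemannZeta (by simpa using hs)).symm
  simp only [Function.comp_apply, this, zetaLogSum, Function.iterate_zero, id_eq, Complex.sub_re]
  congr 1
  rw [Complex.ofReal_add, Complex.ofReal_one, add_sub_cancel_left, ← Complex.ofReal_one,
    ← Complex.ofReal_div, Complex.ofReal_re]

theorem log_div_le {y : ℝ} (h₀ : 0 ≤ y) (h₁ : y < 1) :
    Real.log ((1 + y) / (1 - y)) ≤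
      2 * (y + y ^ 3 / 3 + y ^ 5 / 5 + y ^ 7 / 7 + y ^ 9 / (1 - y ^ 2)) := by
  have h := Real.log_div_le_sum_range_add h₀ h₁ 4
  norm_num [Finset.sum_range_succ] at h
  linarith

/-- Upper bound for the logarithm of `p` from those of `p - 1` and `p + 1`. -/
theorem two_mul_log_le {p y : ℝ} (hp : 1 < p) (hy : y = 1 / (2 * p ^ 2 - 1)) :
    2 * Real.log p ≤ Real.log (p - 1) + Real.log (p + 1) +
      2 * (y + y ^ 3 / 3 + y ^ 5 / 5 + y ^ 7 / 7 + y ^ 9 / (1 - y ^ 2)) := by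
  have hd : 1 < 2 * p ^ 2 - 1 := by nlinarith
  have h₀ : 0 ≤ y := by rw [hy]; positivity
  have h₁ : y < 1 := by rw [hy, div_lt_one (by linarith)]; exact hd
  have h := log_div_le h₀ h₁
  have e : (1 + y) / (1 - y) = p ^ 2 / ((p - 1) * (p + 1)) := by
    have a₁ : p - 1 ≠ 0 := by linarith
    have a₂ : p + 1 ≠ 0 := by linarith
    have a₃ : 2 * p ^ 2 - 1 ≠ 0 := by linarith
    have a₄ : 1 - y ≠ 0 := by linarith
    rw [div_eq_div_iff a₄ (mul_ne_zero a₁ a₂), hy]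
    field_simp
    ring
  rw [e, Real.log_div (by positivity) (by nlinarith), Real.log_mul (by linarith) (by linarith),
    Real.log_pow] at h
  push_cast at h
  linarith

theorem log_natCast_mul (m n : ℕ) (hm : m ≠ 0) (hn : n ≠ 0) :
    Real.log ((m * n : ℕ) : ℝ) = Real.log m + Real.log n := by
  rw [Nat.cast_mul, Real.log_mul (by exact_mod_cast hm) (by exact_mod_cast hn)]

/-- Euler-Maclaurin approximation at `32` of minus the first Stieltjes constant. -/
theorem log_sum_lt :
    (0.07281582 : ℝ) < Real.log 32 ^ 2 / 2 - ∑ n ∈ Finset.range 33, Real.log n / n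
      + Real.log 32 / 64 + (1 - Real.log 32) / 32 ^ 2 / 12 := by
  have l4 : Real.log 4 = Real.log 2 + Real.log 2 := by
    exact_mod_cast log_natCast_mul 2 2 (by norm_num) (by norm_num)
  have l6 : Real.log 6 = Real.log 2 + Real.log 3 := by
    exact_mod_cast log_natCast_mul 2 3 (by norm_num) (by norm_num)
  have l8 : Real.log 8 = Real.log 2 + Real.log 4 := by
    exact_mod_cast log_natCast_mul 2 4 (by norm_num) (by norm_num)
  have l9 : Real.log 9 = Real.log 3 + Real.log 3 := by
    exact_mod_cast log_natCast_mul 3 3 (by norm_num) (by norm_num)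
  have l10 : Real.log 10 = Real.log 2 + Real.log 5 := by
    exact_mod_cast log_natCast_mul 2 5 (by norm_num) (by norm_num)
  have l12 : Real.log 12 = Real.log 2 + Real.log 6 := by
    exact_mod_cast log_natCast_mul 2 6 (by norm_num) (by norm_num)
  have l14 : Real.log 14 = Real.log 2 + Real.log 7 := by
    exact_mod_cast log_natCast_mul 2 7 (by norm_num) (by norm_num)
  have l15 : Real.log 15 = Real.log 3 + Real.log 5 := by
    exact_mod_cast log_natCast_mul 3 5 (by norm_num) (by norm_num)
  have l16 : Real.log 16 = Real.log 2 + Real.log 8 := by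
    exact_mod_cast log_natCast_mul 2 8 (by norm_num) (by norm_num)
  have l18 : Real.log 18 = Real.log 2 + Real.log 9 := by
    exact_mod_cast log_natCast_mul 2 9 (by norm_num) (by norm_num)
  have l20 : Real.log 20 = Real.log 2 + Real.log 10 := by
    exact_mod_cast log_natCast_mul 2 10 (by norm_num) (by norm_num)
  have l21 : Real.log 21 = Real.log 3 + Real.log 7 := by
    exact_mod_cast log_natCast_mul 3 7 (by norm_num) (by norm_num)
  have l22 : Real.log 22 = Real.log 2 + Real.log 11 := by
    exact_mod_cast log_natCast_mul 2 11 (by norm_num) (by norm_num)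
  have l24 : Real.log 24 = Real.log 2 + Real.log 12 := by
    exact_mod_cast log_natCast_mul 2 12 (by norm_num) (by norm_num)
  have l25 : Real.log 25 = Real.log 5 + Real.log 5 := by
    exact_mod_cast log_natCast_mul 5 5 (by norm_num) (by norm_num)
  have l26 : Real.log 26 = Real.log 2 + Real.log 13 := by
    exact_mod_cast log_natCast_mul 2 13 (by norm_num) (by norm_num)
  have l27 : Real.log 27 = Real.log 3 + Real.log 9 := by
    exact_mod_cast log_natCast_mul 3 9 (by norm_num) (by norm_num)
  have l28 : Real.log 28 = Real.log 2 + Real.log 14 := by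
    exact_mod_cast log_natCast_mul 2 14 (by norm_num) (by norm_num)
  have l30 : Real.log 30 = Real.log 2 + Real.log 15 := by
    exact_mod_cast log_natCast_mul 2 15 (by norm_num) (by norm_num)
  have l32 : Real.log 32 = Real.log 2 + Real.log 16 := by
    exact_mod_cast log_natCast_mul 2 16 (by norm_num) (by norm_num)
  have b3 := two_mul_log_le (p := 3) (by norm_num) rfl
  have b5 := two_mul_log_le (p := 5) (by norm_num) rfl
  have b7 := two_mul_log_le (p := 7) (by norm_num) rfl
  have b11 := two_mul_log_le (p := 11) (by norm_num) rfl
  have b13 := two_mul_log_le (p := 13) (by norm_num) rfl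
  have b17 := two_mul_log_le (p := 17) (by norm_num) rfl
  have b19 := two_mul_log_le (p := 19) (by norm_num) rfl
  have b23 := two_mul_log_le (p := 23) (by norm_num) rfl
  have b29 := two_mul_log_le (p := 29) (by norm_num) rfl
  have b31 := two_mul_log_le (p := 31) (by norm_num) rfl
  norm_num at b3 b5 b7 b11 b13 b17 b19 b23 b29 b31
  have hlo := Real.log_two_gt_d9
  have hhi := Real.log_two_lt_d9
  simp only [Finset.sum_range_succ, Finset.sum_range_zero]
  norm_num
  have hsq : 25 * (2 * 0.6931471803 * Real.log 2 - 0.6931471803 ^ 2) ≤ Real.log 32 ^ 2 := by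
    have : Real.log 32 = 5 * Real.log 2 := by linarith
    rw [this]; nlinarith [sq_nonneg (Real.log 2 - 0.6931471803)]
  linarith

theorem HasDerivAt.logQuadRpow_congr {A B C a A' B' C' a' x : ℝ} (hx : 0 < x)
    (hA : A' = B - a * A) (hB : B' = 2 * C - a * B) (hC : C' = -(a * C)) (ha : a' = a + 1) :
    HasDerivAt (logQuadRpow A B C a) (logQuadRpow A' B' C' a' x) x := by
  subst hA hB hC ha
  exact hasDerivAt_logQuadRpow A B C a hx

theorem eulerMascheroniConstant_le : Real.eulerMascheroniConstant ≤ 0.577215676 := by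
  have hpos (x : ℝ) (hx : ((32 : ℕ) : ℝ) ≤ x) : 0 < x := by
    push_cast at hx; linarith
  have h := limit_le_eulerMaclaurin (N := 32) (F := Real.log) (f := logQuadRpow 1 0 0 1)
    (f₁ := logQuadRpow (-1) 0 0 2) (f₂ := logQuadRpow 2 0 0 3) (f₃ := logQuadRpow (-6) 0 0 4)
    (f₄ := logQuadRpow 24 0 0 5) (ℓ := Real.eulerMascheroniConstant)
    (fun x hx => (Real.hasDerivAt_log (hpos x hx).ne').congr_deriv
      (by simp [logQuadRpow, Real.rpow_neg_one]))
    (fun x hx => .logQuadRpow_congr (hpos x hx) (by norm_num) (by norm_num) (by norm_num)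
      (by norm_num))
    (fun x hx => .logQuadRpow_congr (hpos x hx) (by norm_num) (by norm_num) (by norm_num)
      (by norm_num))
    (fun x hx => .logQuadRpow_congr (hpos x hx) (by norm_num) (by norm_num) (by norm_num)
      (by norm_num))
    (fun x hx => .logQuadRpow_congr (hpos x hx) (by norm_num) (by norm_num) (by norm_num)
      (by norm_num))
    (fun x hx => by have := hpos x hx; norm_num [logQuadRpow]; positivity)
    (tendsto_logQuadRpow_atTop _ _ _ (by norm_num))
    (tendsto_logQuadRpow_atTop _ _ _ (by norm_num))
    (by
      refine Real.tendsto_harmonic_sub_log.congr fun M => ?_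
      rw [Finset.sum_range_succ', harmonic]
      simp [logQuadRpow, Real.rpow_neg_one])
  have h32 : Real.log 32 = 5 * Real.log 2 := by
    rw [show (32 : ℝ) = 2 ^ 5 by norm_num, Real.log_pow]; norm_num
  have hsum : ∑ n ∈ Finset.range 33, logQuadRpow 1 0 0 1 n = ∑ n ∈ Finset.range 33, (n : ℝ)⁻¹ :=
    Finset.sum_congr rfl fun n _ => by simp [logQuadRpow, Real.rpow_neg_one]
  have h2 : logQuadRpow (-1) 0 0 2 32 = -(1 / 1024) := by
    simp only [logQuadRpow]
    rw [Real.rpow_neg (by norm_num)]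
    norm_num
  have h1 : logQuadRpow 1 0 0 1 32 = 1 / 32 := by
    norm_num [logQuadRpow, Real.rpow_neg_one]
  simp only [hsum, Nat.cast_ofNat, h1, h2, h32] at h
  have := Real.log_two_gt_d9
  norm_num [Finset.sum_range_succ] at h
  linarith

theorem lt_eulerMascheroniConstant : 0.545 < Real.eulerMascheroniConstant := by
  refine lt_trans ?_ (Real.eulerMascheroniSeq_lt_eulerMascheroniConstant 15)
  have h16 : Real.log 16 = 4 * Real.log 2 := by
    rw [show (16 : ℝ) = 2 ^ 4 by norm_num, Real.log_pow]; norm_num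
  have := Real.log_two_lt_d9
  norm_num [Real.eulerMascheroniSeq, harmonic, Finset.sum_range_succ, h16]
  linarith

theorem sub_le_one_sub_exp {y : ℝ} (hy : 0 ≤ y) :
    y ^ 2 / 2 - y ^ 3 / 3 ≤ 1 - Real.exp (-y) * (1 + y) := by
  have h := nonpos_of_hasDerivAt_nonpos (a := 0) (b := y)
    (g := fun x => x ^ 2 / 2 - x ^ 3 / 3 - (1 - Real.exp (-x) * (1 + x)))
    (g' := fun x => x * (1 - x - Real.exp (-x))) (by simp) ?_ ?_ y ⟨hy, le_rfl⟩
  · linarith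
  · intro x _
    refine (((((hasDerivAt_id x).pow 2).div_const 2).sub
      (((hasDerivAt_id x).pow 3).div_const 3)).sub (((((hasDerivAt_id x).neg).exp).mul
      ((hasDerivAt_id x).const_add 1)).const_sub 1)).congr_deriv ?_
    simp; ring
  · intro x hx
    have := Real.one_sub_le_exp_neg x
    exact mul_nonpos_of_nonneg_of_nonpos hx.1 (by linarith)

theorem tendsto_sum_logQuadRpow_sub {A B C a : ℝ} (k : ℕ) {σ : ℝ} (hσ : 1 < σ) (ha : 0 < a)
    {f : ℝ → ℝ} (hf : ∀ n : ℕ, f n = Real.log n ^ k * (n : ℝ) ^ (-σ)) :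
    Tendsto (fun M : ℕ => ∑ n ∈ Finset.range (M + 1), f n - logQuadRpow A B C a M) atTop
      (𝓝 (zetaLogSum k σ)) := by
  have h := (tendsto_zetaLogSum k hσ).sub
    ((tendsto_logQuadRpow_atTop A B C ha).comp (tendsto_natCast_atTop_atTop (R := ℝ)))
  simpa [hf] using h

/-- Lower bound for the derivative of `ζ(1 + s) - 1 / s`. -/
theorem le_inv_sq_sub_zetaLogSum_one {s : ℝ} (hs : 0 < s) :
    Real.log 32 ^ 2 / 2 - s * Real.log 32 ^ 3 / 3
      - ∑ n ∈ Finset.range 33, logQuadRpow 0 1 0 (1 + s) n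
      + logQuadRpow 0 1 0 (1 + s) 32 / 2 + logQuadRpow 1 (-(1 + s)) 0 (2 + s) 32 / 12 ≤
    1 / s ^ 2 - zetaLogSum 1 (1 + s) := by
  have hpos (x : ℝ) (hx : ((32 : ℕ) : ℝ) ≤ x) : 0 < x := by
    push_cast at hx; linarith
  have h32 : Real.log 32 = 5 * Real.log 2 := by
    rw [show (32 : ℝ) = 2 ^ 5 by norm_num, Real.log_pow]; norm_num
  have hl2 := Real.log_two_gt_d9
  have h := limit_le_eulerMaclaurin (N := 32) (F := logQuadRpow (-(1 / s ^ 2)) (-(1 / s)) 0 s)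
    (f := logQuadRpow 0 1 0 (1 + s))
    (f₁ := logQuadRpow 1 (-(1 + s)) 0 (2 + s))
    (f₂ := logQuadRpow (-(3 + 2 * s)) ((1 + s) * (2 + s)) 0 (3 + s))
    (f₃ := logQuadRpow ((1 + s) * (2 + s) + (3 + s) * (3 + 2 * s))
      (-((1 + s) * (2 + s) * (3 + s))) 0 (4 + s))
    (f₄ := logQuadRpow (-((1 + s) * (2 + s) * (3 + s))
        - (4 + s) * ((1 + s) * (2 + s) + (3 + s) * (3 + 2 * s)))
      ((1 + s) * (2 + s) * (3 + s) * (4 + s)) 0 (5 + s)) (ℓ := zetaLogSum 1 (1 + s))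
    (fun x hx => .logQuadRpow_congr (hpos x hx) (by field_simp; ring) (by field_simp; ring)
      (by ring) (by ring))
    (fun x hx => .logQuadRpow_congr (hpos x hx) (by ring) (by ring) (by ring) (by ring))
    (fun x hx => .logQuadRpow_congr (hpos x hx) (by ring) (by ring) (by ring) (by ring))
    (fun x hx => .logQuadRpow_congr (hpos x hx) (by ring) (by ring) (by ring) (by ring))
    (fun x hx => .logQuadRpow_congr (hpos x hx) (by ring) (by ring) (by ring) (by ring))
    (fun x hx => by
      have hx0 := hpos x hx
      have hlx : 3 ≤ Real.log x := by
        have := Real.log_le_log (by norm_num) (show (32 : ℝ) ≤ x by exact_mod_cast hx)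
        linarith
      refine mul_nonneg ?_ (Real.rpow_nonneg hx0.le _)
      have : (1 + s) * (2 + s) * (3 + s) * (4 + s) * 3 ≤
          (1 + s) * (2 + s) * (3 + s) * (4 + s) * Real.log x := by gcongr
      have : 0 ≤ (1 + s) * (2 + s) * (3 + s) * (4 + s) * 3 - ((1 + s) * (2 + s) * (3 + s)
        + (4 + s) * ((1 + s) * (2 + s) + (3 + s) * (3 + 2 * s))) := by
        ring_nf; positivity
      linarith)
    (tendsto_logQuadRpow_atTop _ _ _ (by linarith))
    (tendsto_logQuadRpow_atTop _ _ _ (by linarith))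
    (tendsto_sum_logQuadRpow_sub 1 (by linarith) hs fun n => by simp [logQuadRpow])
  have hF : Real.log 32 ^ 2 / 2 - s * Real.log 32 ^ 3 / 3 ≤
      1 / s ^ 2 + logQuadRpow (-(1 / s ^ 2)) (-(1 / s)) 0 s 32 := by
    have hy := sub_le_one_sub_exp (y := s * Real.log 32) (by rw [h32]; positivity)
    rw [logQuadRpow_eq_exp _ _ _ _ (by norm_num)]
    calc _ = ((s * Real.log 32) ^ 2 / 2 - (s * Real.log 32) ^ 3 / 3) / s ^ 2 := by
          field_simp
      _ ≤ (1 - Real.exp (-(s * Real.log 32)) * (1 + s * Real.log 32)) / s ^ 2 := by gcongr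
      _ = _ := by field_simp; ring
  simp only [Nat.cast_ofNat, Nat.reduceAdd] at h
  linarith

theorem continuous_logQuadRpow_one (n : ℕ) :
    Continuous fun s : ℝ => logQuadRpow 0 1 0 (1 + s) n := by
  rcases eq_or_ne n 0 with rfl | hn
  · simpa [logQuadRpow] using continuous_const
  · have hn : (n : ℝ) ≠ 0 := by exact_mod_cast hn
    unfold logQuadRpow
    exact continuous_const.mul ((Real.continuous_const_rpow hn).comp (by fun_prop))

theorem log_mul_mul_exp_le {r u : ℝ} (hr : 1 ≤ r) (hu : 0 ≤ u) :
    (2 * u - r * u ^ 2) * Real.exp (-((r + 1) * u)) ≤ 0.29 := by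
  rcases le_total (2 * u - r * u ^ 2) 0 with h | h
  · exact (mul_nonpos_of_nonpos_of_nonneg h (Real.exp_pos _).le).trans (by norm_num)
  have e₁ : (2 * u - r * u ^ 2) * Real.exp (-((r + 1) * u)) ≤
      (2 * u - u ^ 2) * Real.exp (-(2 * u)) := by
    apply mul_le_mul _ _ (Real.exp_pos _).le
    · nlinarith [sq_nonneg u]
    · nlinarith [sq_nonneg u]
    · apply Real.exp_le_exp.2; nlinarith
  have e₂ : 2.13 * (1 + (2 * u - 0.76)) ≤ Real.exp (2 * u) := by
    have a : (2.13 : ℝ) ≤ Real.exp 0.76 := by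
      have := Real.sum_le_exp_of_nonneg (x := 0.76) (by norm_num) 6
      norm_num [Finset.sum_range_succ, Nat.factorial] at this
      linarith
    have b : Real.exp (2 * u) = Real.exp 0.76 * Real.exp (2 * u - 0.76) := by
      rw [← Real.exp_add]; ring_nf
    have c := Real.add_one_le_exp (2 * u - 0.76)
    rw [b]
    rcases le_total 0 (1 + (2 * u - 0.76)) with hp | hp
    · exact mul_le_mul a (by linarith) hp (Real.exp_pos _).le
    · exact (mul_nonpos_of_nonneg_of_nonpos (by norm_num) hp).trans (by positivity)
  refine e₁.trans ?_
  rw [Real.exp_neg, ← div_eq_mul_inv, div_le_iff₀ (Real.exp_pos _)]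
  nlinarith [sq_nonneg (u - 0.3823)]

theorem neg_log_mul_mul_exp_le {r u : ℝ} (hu : 0 ≤ u) :
    -((2 * u - r * u ^ 2) * Real.exp (-((r + 1) * u))) ≤ 0.02 := by
  have h₁ : u * Real.exp (-u) ≤ Real.exp (-1) := by
    have := Real.add_one_le_exp (u - 1)
    calc u * Real.exp (-u) ≤ Real.exp (u - 1) * Real.exp (-u) := by gcongr; linarith
      _ = _ := by rw [← Real.exp_add]; ring_nf
  have h₂ : (r * u - 2) * Real.exp (-(r * u)) ≤ Real.exp (-3) := by
    have := Real.add_one_le_exp (r * u - 3)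
    calc _ ≤ Real.exp (r * u - 3) * Real.exp (-(r * u)) := by gcongr; linarith
      _ = _ := by rw [← Real.exp_add]; ring_nf
  have e : -((2 * u - r * u ^ 2) * Real.exp (-((r + 1) * u))) =
      ((r * u - 2) * Real.exp (-(r * u))) * (u * Real.exp (-u)) := by
    rw [show -((r + 1) * u) = -(r * u) + -u by ring, Real.exp_add]; ring
  have h₃ : Real.exp (-3) * Real.exp (-1) ≤ 0.02 := by
    rw [← Real.exp_add, show (-3 + -1 : ℝ) = -(4 * 1) by norm_num, Real.exp_neg]
    have : (2.7 : ℝ) ^ 4 ≤ Real.exp (4 * 1) := by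
      rw [show Real.exp (4 * 1) = Real.exp 1 ^ 4 by rw [← Real.exp_nat_mul]; norm_num]
      have := Real.exp_one_gt_d9
      gcongr; linarith
    exact (inv_anti₀ (by norm_num) this).trans (by norm_num)
  rw [e]
  calc _ ≤ Real.exp (-3) * (u * Real.exp (-u)) := by gcongr
    _ ≤ Real.exp (-3) * Real.exp (-1) := by gcongr
    _ ≤ _ := h₃

/-- Lower bound for the second derivative of `ζ(1 + s) - 1 / s`. -/
theorem le_zetaLogSum_two_sub {s : ℝ} (hs : 0 < s) :
    -(0.31 / 8) ≤ zetaLogSum 2 (1 + s) - 2 / s ^ 3 := by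
  obtain ⟨r, hr⟩ : ∃ r, r = 1 + s := ⟨_, rfl⟩
  have hr1 : 1 < r := by linarith
  have hrr : 0 < r * (r + 1) := by positivity
  set D := √(2 * r ^ 2 + 2 * r + 1) with hD
  have hD2 : D ^ 2 = 2 * r ^ 2 + 2 * r + 1 := Real.sq_sqrt (by positivity)
  have hD0 : 0 ≤ D := Real.sqrt_nonneg _
  set u₁ := (2 * r + 1 - D) / (r * (r + 1)) with hu₁
  set u₂ := (2 * r + 1 + D) / (r * (r + 1)) with hu₂
  have hu₁0 : 0 ≤ u₁ := div_nonneg (by nlinarith) hrr.le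
  have hu12 : u₁ ≤ u₂ := by rw [hu₁, hu₂]; gcongr; linarith
  have hfac (u : ℝ) : 2 + -(4 * r + 2) * u + r * (r + 1) * u ^ 2 =
      r * (r + 1) * ((u - u₁) * (u - u₂)) := by
    have a : r * (r + 1) * u₁ = 2 * r + 1 - D := by rw [hu₁]; field_simp
    have b : r * (r + 1) * u₂ = 2 * r + 1 + D := by rw [hu₂]; field_simp
    have c : r * (r + 1) * (u₁ * u₂) = 2 := by
      have : (r * (r + 1)) * (r * (r + 1) * (u₁ * u₂)) = (r * (r + 1)) * 2 := by
        calc _ = (r * (r + 1) * u₁) * (r * (r + 1) * u₂) := by ring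
          _ = _ := by rw [a, b]; linear_combination -hD2
      exact mul_left_cancel₀ hrr.ne' this
    linear_combination u * a + u * b - c
  set x₁ := Real.exp u₁ with hx₁
  set x₂ := Real.exp u₂ with hx₂
  have hx₁1 : 1 ≤ x₁ := Real.one_le_exp hu₁0
  have hx12 : x₁ ≤ x₂ := Real.exp_le_exp.2 hu12
  set g := logQuadRpow 0 2 (-r) (r + 1) with hg
  have hg' (x : ℝ) (hx : 1 ≤ x) : HasDerivAt g
      (r * (r + 1) * ((Real.log x - u₁) * (Real.log x - u₂)) * x ^ (-(r + 2))) x := by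
    rw [← hfac]
    exact .logQuadRpow_congr (by linarith) (by ring) (by ring) (by ring) (by ring)
  have hcont (S : Set ℝ) (hS : ∀ x ∈ S, 1 ≤ x) : ContinuousOn g S := fun x hx =>
    (hg' x (hS x hx)).continuousAt.continuousWithinAt
  have hge {x u : ℝ} (hx : Real.exp u ≤ x) : u ≤ Real.log x :=
    (Real.le_log_iff_exp_le ((Real.exp_pos u).trans_le hx)).2 hx
  have hle {x u : ℝ} (hx0 : 1 ≤ x) (hx : x ≤ Real.exp u) : Real.log x ≤ u :=
    (Real.log_le_iff_le_exp (by linarith)).2 hx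
  have m₁ : MonotoneOn g (Set.Icc 1 x₁) := by
    refine monotoneOn_of_hasDerivWithinAt_nonneg (convex_Icc _ _) (hcont _ fun x hx => hx.1)
      (fun x hx => (hg' x (interior_subset hx).1).hasDerivWithinAt) fun x hx => ?_
    have hx := interior_subset hx
    have := hle hx.1 hx.2
    refine mul_nonneg (mul_nonneg hrr.le (mul_nonneg_of_nonpos_of_nonpos ?_ ?_))
      (Real.rpow_nonneg (by linarith [hx.1]) _) <;> linarith
  have m₂ : AntitoneOn g (Set.Icc x₁ x₂) := by
    refine antitoneOn_of_hasDerivWithinAt_nonpos (convex_Icc _ _)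
      (hcont _ fun x hx => hx₁1.trans hx.1)
      (fun x hx => (hg' x (hx₁1.trans (interior_subset hx).1)).hasDerivWithinAt) fun x hx => ?_
    have hx := interior_subset hx
    have := hle (hx₁1.trans hx.1) hx.2
    have := hge hx.1
    refine mul_nonpos_of_nonpos_of_nonneg (mul_nonpos_of_nonneg_of_nonpos hrr.le
      (mul_nonpos_of_nonneg_of_nonpos ?_ ?_)) (Real.rpow_nonneg (by linarith [hx.1]) _) <;> linarith
  have m₃ : MonotoneOn g (Set.Ici x₂) := by
    have h1 (x : ℝ) (hx : x ∈ Set.Ici x₂) : 1 ≤ x := hx₁1.trans (hx12.trans hx)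
    refine monotoneOn_of_hasDerivWithinAt_nonneg (convex_Ici _) (hcont _ h1)
      (fun x hx => (hg' x (h1 x (interior_subset hx))).hasDerivWithinAt) fun x hx => ?_
    have hx := interior_subset hx
    have := hge hx
    have := h1 x hx
    refine mul_nonneg (mul_nonneg hrr.le (mul_nonneg ?_ ?_))
      (Real.rpow_nonneg (by linarith) _) <;> linarith
  have hgexp (x : ℝ) (hx : 1 ≤ x) : g x =
      (2 * Real.log x - r * Real.log x ^ 2) * Real.exp (-((r + 1) * Real.log x)) := by
    rw [hg, logQuadRpow_eq_exp _ _ _ _ (by linarith)]; ring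
  have hcl (x : ℝ) : max x₁ (min x x₂) ∈ Set.Icc x₁ x₂ :=
    ⟨le_max_left _ _, max_le hx12 (min_le_right _ _)⟩
  have h := le_limit_of_decrease_le (N := 1) (F := logQuadRpow (-(2 / s ^ 3)) (-(2 / s ^ 2)) (-(1 / s)) s)
    (f := logQuadRpow 0 0 1 r) (f₁ := g)
    (ψ := fun x => g (min x x₁) + g (max x x₂) - g x₁ - g x₂)
    (W := fun x => -g (max x₁ (min x x₂))) (ℓ := zetaLogSum 2 r) (V := 0.31)
    (fun x hx => .logQuadRpow_congr (by push_cast at hx; linarith) (by field_simp; ring)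
      (by field_simp; ring) (by field_simp) (by linarith))
    (fun x hx => .logQuadRpow_congr (by push_cast at hx; linarith) (by ring) (by ring) (by ring)
      (by ring))
    (fun x hx => by
      rcases le_total x x₁ with h1 | h1
      · simp [min_eq_left h1, min_eq_left (h1.trans hx12), max_eq_left h1,
          max_eq_right (h1.trans hx12)]
        ring
      · rcases le_total x x₂ with h2 | h2
        · simp [min_eq_right h1, min_eq_left h2, max_eq_right h1, max_eq_right h2]
        · simp [min_eq_right h1, min_eq_right h2, max_eq_right hx12, max_eq_left h2])
    (fun x hx y hy hxy => by
      simp only [Nat.cast_one, Set.mem_Ici] at hx hy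
      have a := m₁ ⟨le_min hx hx₁1, min_le_right x x₁⟩ ⟨le_min hy hx₁1, min_le_right y x₁⟩
        (min_le_min_right x₁ hxy)
      have b := m₃ (le_max_right x x₂) (le_max_right y x₂) (max_le_max_right x₂ hxy)
      simp only
      linarith)
    (fun x _ y _ hxy => neg_le_neg
      (m₂ (hcl x) (hcl y) (max_le_max_left x₁ (min_le_min_right x₂ hxy))))
    (fun x _ => by
      have a := hx₁1.trans (hcl (1 : ℕ)).1
      have b := hx₁1.trans (hcl x).1
      have := log_mul_mul_exp_le hr1.le (Real.log_nonneg a)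
      have := neg_log_mul_mul_exp_le (r := r) (Real.log_nonneg b)
      rw [hgexp _ a, hgexp _ b]
      linarith)
    (tendsto_logQuadRpow_atTop _ _ _ (by linarith))
    (tendsto_sum_logQuadRpow_sub 2 hr1 hs fun n => by simp [logQuadRpow])
  rw [hr] at h
  norm_num [Finset.sum_range_succ, logQuadRpow] at h
  norm_num
  linarith

theorem monotoneOn_Ioi_of_hasDerivAt_nonneg {g g' : ℝ → ℝ}
    (hg : ∀ x, 0 < x → HasDerivAt g (g' x) x) (hg' : ∀ x, 0 < x → 0 ≤ g' x) :
    MonotoneOn g (Set.Ioi 0) := by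
  refine monotoneOn_of_hasDerivWithinAt_nonneg (convex_Ioi 0)
    (fun y hy => (hg y hy).continuousAt.continuousWithinAt)
    (fun y hy => (hg y (interior_subset hy)).hasDerivWithinAt)
    (fun y hy => hg' y (interior_subset hy))

theorem le_of_monotoneOn_Ioi {g b : ℝ → ℝ} {c s : ℝ} (hg : MonotoneOn g (Set.Ioi 0)) (hs : 0 < s)
    (hb : ∀ x, 0 < x → b x ≤ g x) (hc : Tendsto b (𝓝[>] 0) (𝓝 c)) : c ≤ g s := by
  refine le_of_tendsto hc ?_
  filter_upwards [Ioo_mem_nhdsGT hs] with x hx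
  exact (hb x hx.1).trans (hg hx.1 hs hx.2.le)

theorem hasDerivAt_zetaLogSum_one_add (k : ℕ) {s : ℝ} (hs : 0 < s) :
    HasDerivAt (fun s => zetaLogSum k (1 + s)) (-zetaLogSum (k + 1) (1 + s)) s := by
  exact (hasDerivAt_zetaLogSum k (by linarith : 1 < 1 + s)).comp_const_add 1 s

theorem le_inv_sq_sub_zetaLogSum_one_of_pos {s : ℝ} (hs : 0 < s) :
    0.07281582 - 0.03875 * s ≤ 1 / s ^ 2 - zetaLogSum 1 (1 + s) := by
  have hm : MonotoneOn (fun s => 1 / s ^ 2 - zetaLogSum 1 (1 + s) + 0.03875 * s) (Set.Ioi 0) := by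
    refine monotoneOn_Ioi_of_hasDerivAt_nonneg
      (g' := fun s => -(2 / s ^ 3) + zetaLogSum 2 (1 + s) + 0.03875) ?_ ?_
    · intro x hx
      have := (((hasDerivAt_id x).pow 2).fun_inv (pow_ne_zero 2 hx.ne')).congr_deriv
        (g' := -(2 / x ^ 3)) (by simp; field_simp)
      simp only [one_div]
      refine ((this.sub (hasDerivAt_zetaLogSum_one_add 1 hx)).add
        ((hasDerivAt_id x).const_mul 0.03875)).congr_deriv ?_
      simp
    · intro x hx
      have := le_zetaLogSum_two_sub hx
      norm_num at this ⊢
      linarith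
  set b : ℝ → ℝ := fun s => Real.log 32 ^ 2 / 2 - s * Real.log 32 ^ 3 / 3
      - ∑ n ∈ Finset.range 33, logQuadRpow 0 1 0 (1 + s) n
      + logQuadRpow 0 1 0 (1 + s) 32 / 2 + logQuadRpow 1 (-(1 + s)) 0 (2 + s) 32 / 12 with hb
  have hbc : Continuous b := by
    have c₁ := continuous_finsetSum (Finset.range 33) fun n _ => continuous_logQuadRpow_one n
    have c₂ := continuous_logQuadRpow_one 32
    have c₃ : Continuous fun s : ℝ => logQuadRpow 1 (-(1 + s)) 0 (2 + s) 32 := by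
      unfold logQuadRpow
      exact Continuous.mul (by fun_prop)
        ((Real.continuous_const_rpow (by norm_num)).comp (by fun_prop))
    push_cast at c₂
    exact ((Continuous.sub (by fun_prop) c₁).add (c₂.div_const 2)).add (c₃.div_const 12)
  have hb0 : 0.07281582 < b 0 := by
    have hsum : ∑ n ∈ Finset.range 33, logQuadRpow 0 1 0 (1 + 0) n =
        ∑ n ∈ Finset.range 33, Real.log n / n :=
      Finset.sum_congr rfl fun n _ => by simp [logQuadRpow, Real.rpow_neg_one, div_eq_mul_inv]
    have e₁ : logQuadRpow 0 1 0 (1 + 0) 32 = Real.log 32 / 32 := by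
      simp [logQuadRpow, Real.rpow_neg_one, div_eq_mul_inv]
    have e₂ : logQuadRpow 1 (-(1 + 0)) 0 (2 + 0) 32 = (1 - Real.log 32) / 32 ^ 2 := by
      simp only [logQuadRpow]
      rw [Real.rpow_neg (by norm_num), div_eq_mul_inv, ← Real.rpow_natCast]
      norm_num
      ring
    have := log_sum_lt
    simp only [hb, hsum, e₁, e₂]
    linarith
  have h := le_of_monotoneOn_Ioi hm hs (b := b) (c := b 0) (fun x hx => by
      have := le_inv_sq_sub_zetaLogSum_one hx
      simp only [hb]
      linarith)
    ((hbc.tendsto 0).mono_left nhdsWithin_le_nhds)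
  linarith

theorem le_zetaLogSum_zero_sub {s : ℝ} (hs : 0 < s) :
    Real.eulerMascheroniConstant + 0.07281582 * s - 0.03875 / 2 * s ^ 2 ≤
      zetaLogSum 0 (1 + s) - 1 / s := by
  have hm : MonotoneOn (fun s => zetaLogSum 0 (1 + s) - 1 / s
      - 0.07281582 * s + 0.03875 / 2 * s ^ 2) (Set.Ioi 0) := by
    refine monotoneOn_Ioi_of_hasDerivAt_nonneg
      (g' := fun s => 1 / s ^ 2 - zetaLogSum 1 (1 + s) - (0.07281582 - 0.03875 * s)) ?_
      fun x hx => sub_nonneg.2 (le_inv_sq_sub_zetaLogSum_one_of_pos hx)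
    intro x hx
    simp only [one_div]
    refine ((((hasDerivAt_zetaLogSum_one_add 0 hx).sub (hasDerivAt_inv hx.ne')).sub
      ((hasDerivAt_id x).const_mul 0.07281582)).add
      (((hasDerivAt_id x).pow 2).const_mul (0.03875 / 2))).congr_deriv ?_
    simp; ring
  have h := le_of_monotoneOn_Ioi hm hs (fun x hx => le_rfl) (c := Real.eulerMascheroniConstant) (by
    have : Tendsto (fun s : ℝ => 0.07281582 * s - 0.03875 / 2 * s ^ 2) (𝓝[>] 0) (𝓝 0) := by
      have : Continuous fun s : ℝ => 0.07281582 * s - 0.03875 / 2 * s ^ 2 := by fun_prop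
      simpa using (this.tendsto 0).mono_left nhdsWithin_le_nhds
    have := tendsto_zetaLogSum_zero_sub.sub this
    rw [sub_zero] at this
    exact this.congr fun s => by ring)
  linarith

/-- Israilov: for real `1 < σ ≤ 2`,
`-ζ'(σ)/ζ(σ) < 1/(σ-1) - γ + C1 (σ-1)` with `C1 = 0.1875463`. -/
theorem stmt_12
    (σ : ℝ) (h1 : 1 < σ) (h2 : σ ≤ 2) :
    ((-(deriv riemannZeta (σ : ℂ))) / riemannZeta (σ : ℂ)).re <
      1 / (σ - 1) - Real.eulerMascheroniConstant + 0.1875463 * (σ - 1) := by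
  rw [neg_deriv_div_riemannZeta_re h1]
  obtain ⟨s, rfl⟩ : ∃ s, σ = 1 + s := ⟨σ - 1, by ring⟩
  have hs : 0 < s := by linarith
  have hs1 : s ≤ 1 := by linarith
  rw [add_sub_cancel_left]
  have hE₁ := le_inv_sq_sub_zetaLogSum_one_of_pos hs
  have hE₀ := le_zetaLogSum_zero_sub hs
  have hγ₁ := eulerMascheroniConstant_le
  have hγ₀ := lt_eulerMascheroniConstant
  set γ := Real.eulerMascheroniConstant
  obtain ⟨G, hG⟩ : ∃ G, G = zetaLogSum 0 (1 + s) - 1 / s := ⟨_, rfl⟩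
  obtain ⟨G', hG'⟩ : ∃ G', G' = 1 / s ^ 2 - zetaLogSum 1 (1 + s) := ⟨_, rfl⟩
  rw [← hG] at hE₀
  rw [← hG'] at hE₁
  rw [show zetaLogSum 0 (1 + s) = G + 1 / s by linarith,
    show zetaLogSum 1 (1 + s) = 1 / s ^ 2 - G' by linarith]
  have hG0 : 0 < G := by nlinarith
  have hi : 0 < 1 / s := by positivity
  rw [div_lt_iff₀ (by linarith)]
  have hcoef : 0 < 1 - s * (γ - 0.1875463 * s) := by nlinarith
  have key : 0 < G * (1 - s * (γ - 0.1875463 * s)) + s * G' - γ + 0.1875463 * s := by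
    have a := mul_le_mul_of_nonneg_right hE₀ hcoef.le
    have b := mul_le_mul_of_nonneg_left hE₁ hs.le
    have c : 0 ≤ 0.1875463 + 2 * 0.07281582 - γ ^ 2 := by nlinarith
    have d : 0 < s ^ 2 * (γ * (0.1875463 - 0.07281582) - 0.058125) := by
      have : 0 < γ * (0.1875463 - 0.07281582) - 0.058125 := by linarith
      positivity
    have e : 0 ≤ s ^ 3 * (0.07281582 * 0.1875463 + 0.03875 / 2 * (γ - 0.1875463 * s)) := by
      have : 0 ≤ γ - 0.1875463 * s := by linarith
      positivity
    have f := mul_nonneg hs.le c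
    linarith
  have e : (1 / s - γ + 0.1875463 * s) * (G + 1 / s) - (1 / s ^ 2 - G') =
      (G * (1 - s * (γ - 0.1875463 * s)) + s * G' - γ + 0.1875463 * s) / s := by
    field_simp; ring
  have := div_pos key hs
  linarith
end

section
/- For every real number u > 0, the following two inequalities hold: (i) with y₁ = 1 + √(2u) + (2/3)·u one has y₁·e^(−y₁) ≥ e^(−u−1); and (ii) with y₂ = 1 + √(2u) + u one has y₂·e^(−y₂) ≤ e^(−u−1). (Equivalently, −1 − √(2u) − u < W₋₁(−e^(−u−1)) < −1 − √(2u) − (2/3)·u, where W₋₁ is the lower real branch of the Lambert W function.) -/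
open Real

lemma exp_sub_sq_div_six_le {s : ℝ} (hs : 0 ≤ s) :
    exp (s - s ^ 2 / 6) ≤ 1 + s + s ^ 2 / 3 := by
  let f : ℝ → ℝ := fun x => log (1 + x + x ^ 2 / 3) - x + x ^ 2 / 6
  have hd (x : ℝ) (hx : 0 ≤ x) : HasDerivAt f (x ^ 3 / 9 / (1 + x + x ^ 2 / 3)) x := by
    have hpos : 0 < 1 + x + x ^ 2 / 3 := by positivity
    have hq : HasDerivAt (fun x : ℝ => 1 + x + x ^ 2 / 3) (1 + 2 * x / 3) x := by
      simpa using ((hasDerivAt_id x).const_add 1).fun_add ((hasDerivAt_pow 2 x).div_const 3)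
    have h := ((hq.log hpos.ne').sub (hasDerivAt_id x)).add ((hasDerivAt_pow 2 x).div_const 6)
    refine h.congr_deriv ?_
    push_cast
    field_simp
    ring
  have hmono : MonotoneOn f (Set.Ici 0) := by
    refine monotoneOn_of_hasDerivWithinAt_nonneg (convex_Ici 0)
      (fun x hx => (hd x hx).continuousAt.continuousWithinAt)
      (fun x hx => (hd x (interior_subset hx)).hasDerivWithinAt) fun x hx => ?_
    have hx' : 0 ≤ x := interior_subset hx
    positivity
  have h0 : f 0 ≤ f s := hmono Set.self_mem_Ici hs hs
  have hlog : s - s ^ 2 / 6 ≤ log (1 + s + s ^ 2 / 3) := by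
    simp only [f] at h0
    norm_num at h0
    linarith
  exact (le_log_iff_exp_le (by positivity)).mp hlog

/-- explicit bounds related to the lower branch `W₋₁` of the
Lambert W function: for `u > 0`, with `y₁ = 1 + √(2u) + (2/3)u` and
`y₂ = 1 + √(2u) + u`, one has `y₁ e^(-y₁) ≥ e^(-u-1)` and `y₂ e^(-y₂) ≤ e^(-u-1)`. -/
theorem stmt_13 (u : ℝ) (hu : 0 < u) :
    (1 + Real.sqrt (2 * u) + (2 / 3) * u) *
        Real.exp (-(1 + Real.sqrt (2 * u) + (2 / 3) * u)) ≥ Real.exp (-u - 1)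
    ∧ (1 + Real.sqrt (2 * u) + u) *
        Real.exp (-(1 + Real.sqrt (2 * u) + u)) ≤ Real.exp (-u - 1) := by
  have hs : 0 ≤ √(2 * u) := sqrt_nonneg _
  have hsq : √(2 * u) ^ 2 = 2 * u := sq_sqrt (by positivity)
  generalize √(2 * u) = s at hs hsq ⊢
  obtain rfl : u = s ^ 2 / 2 := by linarith
  constructor
  · calc exp (-(s ^ 2 / 2) - 1)
        = exp (s - s ^ 2 / 6) * exp (-(1 + s + 2 / 3 * (s ^ 2 / 2))) := by
          rw [← exp_add]; ring_nf
      _ ≤ (1 + s + s ^ 2 / 3) * exp (-(1 + s + 2 / 3 * (s ^ 2 / 2))) := by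
          gcongr
          exact exp_sub_sq_div_six_le hs
      _ = _ := by ring
  · calc (1 + s + s ^ 2 / 2) * exp (-(1 + s + s ^ 2 / 2))
        ≤ exp s * exp (-(1 + s + s ^ 2 / 2)) := by
          gcongr
          exact quadratic_le_exp_of_nonneg hs
      _ = exp (-(s ^ 2 / 2) - 1) := by
          rw [← exp_add]; ring_nf
end
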